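/- Let G be a minimal bipartite matching covered graph, not isomorphic to the cycle graph on 4 vertices, satisfying |V2| = 2(m − n + 2). Then: (i) 2m + |V3| + 4 = 3n, where V3 is the set of vertices of degree at least 3; (ii) |E32| + 2n = 2m + 4, where E32 is the set of edges joining a vertex of degree 2 to a vertex of degree at least 3; and (iii) 2m + |E3| + 6 = 3n (equivalently |E3| = |V3| − 2), where E3 is the set of edges both of whose endpoints have degree at least 3. Here n is the number of vertices, m the number of edges, and V2 the set of degree-2 vertices of G. -/

import Mathlib

open SimpleGraph

/-- The degree of a vertex `v` in a graph `G`: the number of neighbours of `v`. -/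
noncomputable def degN {V : Type*} (G : SimpleGraph V) (v : V) : ℕ :=
  (G.neighborSet v).ncard

/-- A finite simple graph is matching covered if it is connected, has at least 4 vertices,
and every edge lies in some perfect matching. -/
def MatchingCovered {V : Type*} [Fintype V] (G : SimpleGraph V) : Prop :=
  G.Connected ∧ 4 ≤ Fintype.card V ∧
    ∀ e ∈ G.edgeSet, ∃ M : G.Subgraph, M.IsPerfectMatching ∧ e ∈ M.edgeSet

/-- A matching covered graph is minimal if deleting any edge destroys the property. -/
def MinimalMatchingCovered {V : Type*} [Fintype V] (G : SimpleGraph V) : Prop :=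
  MatchingCovered G ∧ ∀ e ∈ G.edgeSet, ¬ MatchingCovered (G.deleteEdges {e})

open scoped Classical in
/-- The elements of `B` related to some element of `S`. -/
noncomputable def relNbrs {α β : Type*} (B : Finset β) (R : α → β → Prop) (S : Finset α) :
    Finset β :=
  B.filter fun y => ∃ x ∈ S, R x y

open scoped Classical in
/-- The number of elements of `B` related to `x`. -/
noncomputable def relDeg {α β : Type*} (B : Finset β) (R : α → β → Prop) (x : α) : ℕ :=
  (B.filter fun y => R x y).card

open scoped Classical in
/-- The related pairs in `A × B`. -/
noncomputable def relPairs {α β : Type*} (A : Finset α) (B : Finset β) (R : α → β → Prop) :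
    Finset (α × β) :=
  (A ×ˢ B).filter fun p => R p.1 p.2

/-- A balanced bipartite relation with positive surplus on proper nonempty sets, in which every
edge between vertices of degree at least `3` is the only edge leaving some tight set. -/
structure TightCover {α β : Type*} (A : Finset α) (B : Finset β) (R : α → β → Prop) : Prop where
  left_mem : ∀ {x y}, R x y → x ∈ A
  right_mem : ∀ {x y}, R x y → y ∈ B
  card_eq : A.card = B.card
  surplus : ∀ S ⊆ A, S.Nonempty → S ≠ A → S.card + 1 ≤ (relNbrs B R S).card
  tight : ∀ x y, R x y → 3 ≤ relDeg B R x → 3 ≤ relDeg A (flip R) y →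
    ∃ S ⊆ A, x ∈ S ∧ (relNbrs B R S).card ≤ S.card + 1 ∧ ∀ z ∈ S, R z y → z = x

section RelationLemmas

variable {α β : Type*} {A : Finset α} {B : Finset β} {R : α → β → Prop}

lemma mem_relNbrs {S : Finset α} {y : β} : y ∈ relNbrs B R S ↔ y ∈ B ∧ ∃ x ∈ S, R x y := by
  simp [relNbrs]

lemma mem_relPairs {p : α × β} : p ∈ relPairs A B R ↔ (p.1 ∈ A ∧ p.2 ∈ B) ∧ R p.1 p.2 := by
  simp [relPairs]

lemma relNbrs_subset {S : Finset α} : relNbrs B R S ⊆ B := by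
  intro y hy
  exact (mem_relNbrs.1 hy).1

lemma relNbrs_singleton (x : α) : (relNbrs B R {x}).card = relDeg B R x := by
  unfold relNbrs relDeg
  congr 1
  ext y
  simp

open scoped Classical in
lemma relNbrs_union (S T : Finset α) : relNbrs B R (S ∪ T) = relNbrs B R S ∪ relNbrs B R T := by
  ext y
  simp only [mem_relNbrs, Finset.mem_union]
  grind

lemma card_relPairs_flip : (relPairs B A (flip R)).card = (relPairs A B R).card := by
  refine Finset.card_bij (fun p _ => p.swap) ?_ ?_ ?_
  · intro p hp
    simp only [mem_relPairs, flip] at hp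
    simp [mem_relPairs, hp.1.1, hp.1.2, hp.2]
  · intro p _ q _ h
    exact Prod.swap_injective h
  · intro p hp
    simp only [mem_relPairs] at hp
    exact ⟨p.swap, by simp [mem_relPairs, flip, hp.1.1, hp.1.2, hp.2], by simp⟩

lemma card_relPairs : (relPairs A B R).card = ∑ x ∈ A, relDeg B R x := by
  classical
  unfold relPairs relDeg
  simp only [Finset.card_filter]
  rw [Finset.sum_product]

lemma card_relPairs' : (relPairs A B R).card = ∑ y ∈ B, relDeg A (flip R) y := by
  rw [← card_relPairs_flip, card_relPairs]

lemma exists_ne_of_relDeg {x : α} (y : β) (h : 2 ≤ relDeg B R x) :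
    ∃ y' ∈ B, R x y' ∧ y' ≠ y := by
  classical
  obtain ⟨z, hz, hne⟩ := Finset.exists_mem_ne (s := B.filter fun y => R x y) h y
  rw [Finset.mem_filter] at hz
  exact ⟨z, hz.1, hz.2, hne⟩

lemma exists_ne_ne_of_relDeg {x : α} (y z : β) (h : 3 ≤ relDeg B R x) :
    ∃ y' ∈ B, R x y' ∧ y' ≠ y ∧ y' ≠ z := by
  classical
  have h1 : 2 ≤ ((B.filter fun y => R x y).erase y).card := by
    have := Finset.pred_card_le_card_erase (s := B.filter fun y => R x y) (a := y)
    unfold relDeg at h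
    omega
  obtain ⟨w, hw, hne⟩ := Finset.exists_mem_ne h1 z
  rw [Finset.mem_erase, Finset.mem_filter] at hw
  exact ⟨w, hw.2.1, hw.2.2, hw.1, hne⟩

end RelationLemmas

namespace TightCover

variable {α β : Type*} {A : Finset α} {B : Finset β} {R : α → β → Prop}

lemma surplus_flip (h : TightCover A B R) (T : Finset β) (hT : T ⊆ B) (hne : T.Nonempty)
    (hTB : T ≠ B) : T.card + 1 ≤ (relNbrs A (flip R) T).card := by
  classical
  set N := relNbrs A (flip R) T with hN
  have hNA : N ⊆ A := relNbrs_subset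
  have hlt : T.card < B.card := Finset.card_lt_card (hT.ssubset_of_ne hTB)
  have hc := h.card_eq
  have hsub : relNbrs B R (A \ N) ⊆ B \ T := by
    intro y hy
    obtain ⟨hyB, x, hx, hxy⟩ := mem_relNbrs.1 hy
    rw [Finset.mem_sdiff] at hx ⊢
    exact ⟨hyB, fun hyT => hx.2 (mem_relNbrs.2 ⟨hx.1, y, hyT, hxy⟩)⟩
  have h1 := Finset.card_le_card hsub
  rw [Finset.card_sdiff_of_subset hT] at h1
  have h2 := Finset.card_sdiff_of_subset hNA
  have h3 := Finset.card_le_card hNA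
  by_cases hE : (A \ N).Nonempty
  · by_cases hEA : A \ N = A
    · exfalso
      rw [hEA] at h1
      obtain ⟨x, hx⟩ := hE
      have hTpos := hne.card_pos
      by_cases hA1 : A.card = 1
      · omega
      obtain ⟨S, hS, hScard⟩ := Finset.exists_subset_card_eq (s := A) (n := A.card - 1) (by omega)
      have hs := h.surplus S hS (Finset.card_pos.1 (by omega)) (by rintro rfl; omega)
      have : (relNbrs B R S).card ≤ (relNbrs B R A).card := by
        refine Finset.card_le_card fun y hy => ?_
        obtain ⟨hyB, z, hz, hzy⟩ := mem_relNbrs.1 hy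
        exact mem_relNbrs.2 ⟨hyB, z, hS hz, hzy⟩
      omega
    · have := h.surplus _ Finset.sdiff_subset hE hEA
      omega
  · rw [Finset.not_nonempty_iff_eq_empty] at hE
    rw [hE, Finset.card_empty] at h2
    omega

lemma symm (h : TightCover A B R) : TightCover B A (flip R) where
  left_mem := h.right_mem
  right_mem := h.left_mem
  card_eq := h.card_eq.symm
  surplus := h.surplus_flip
  tight := by
    classical
    intro y x hxy hy hx
    obtain ⟨S, hSA, hxS, hS, huniq⟩ := h.tight x y hxy hx hy
    have hyN : y ∈ relNbrs B R S := mem_relNbrs.2 ⟨h.right_mem hxy, x, hxS, hxy⟩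
    have hNB : relNbrs B R S ⊆ B := relNbrs_subset
    have hsub : relNbrs A (flip R) (insert y (B \ relNbrs B R S)) ⊆ insert x (A \ S) := by
      intro z hz
      obtain ⟨hzA, w, hw, hzw⟩ := mem_relNbrs.1 hz
      rw [Finset.mem_insert, Finset.mem_sdiff] at hw ⊢
      by_cases hzS : z ∈ S
      · rcases hw with rfl | hw
        · exact Or.inl (huniq z hzS hzw)
        · exact absurd (mem_relNbrs.2 ⟨hw.1, z, hzS, hzw⟩) hw.2
      · exact Or.inr ⟨hzA, hzS⟩
    have hSne : S ≠ A := by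
      rintro rfl
      obtain ⟨z, hz, hzy, hne⟩ := exists_ne_of_relDeg x (le_trans (by norm_num) hy)
      exact hne (huniq z hz hzy)
    have hsur := h.surplus S hSA ⟨x, hxS⟩ hSne
    have h1 := Finset.card_le_card hsub
    have h2 := Finset.card_insert_le x (A \ S)
    rw [Finset.card_sdiff_of_subset hSA] at h2
    have h3 := Finset.card_le_card hSA
    have h4 := Finset.card_le_card hNB
    have h5 := h.card_eq
    have h6 : (insert y (B \ relNbrs B R S)).card = B.card - (relNbrs B R S).card + 1 := by
      rw [Finset.card_insert_of_notMem (by simp [hyN]), Finset.card_sdiff_of_subset hNB]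
    refine ⟨insert y (B \ relNbrs B R S), ?_, Finset.mem_insert_self _ _, by omega, ?_⟩
    · exact Finset.insert_subset (h.right_mem hxy) Finset.sdiff_subset
    · intro z hz hzx
      rw [Finset.mem_insert, Finset.mem_sdiff] at hz
      rcases hz with rfl | hz
      · rfl
      · exact absurd (mem_relNbrs.2 ⟨hz.1, x, hxS, hzx⟩) hz.2

lemma two_le_relDeg (h : TightCover A B R) (hA : 2 ≤ A.card) {x : α} (hx : x ∈ A) :
    2 ≤ relDeg B R x := by
  have := h.surplus {x} (by simpa using hx) (by simp) (by rintro rfl; simp at hA)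
  rw [relNbrs_singleton] at this
  simpa using this

lemma disjoint_tight (h : TightCover A B R) {x x' : α} {y : β} {S S' : Finset α}
    (hS : S ⊆ A) (hS' : S' ⊆ A) (hxS : x ∈ S) (hxS' : x' ∈ S') (hxy : R x y) (hxy' : R x' y)
    (hne : x' ≠ x) (hy : 3 ≤ relDeg A (flip R) y)
    (hc : (relNbrs B R S).card ≤ S.card + 1) (hc' : (relNbrs B R S').card ≤ S'.card + 1)
    (hu : ∀ z ∈ S, R z y → z = x) (hu' : ∀ z ∈ S', R z y → z = x') : Disjoint S S' := by
  classical
  by_contra hd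
  rw [Finset.disjoint_iff_inter_eq_empty, ← Finset.not_nonempty_iff_eq_empty, not_not] at hd
  obtain ⟨w, hwA, hwy, hwx, hwx'⟩ := exists_ne_ne_of_relDeg x x' hy
  have hUne : S ∪ S' ≠ A := by
    intro he
    rw [← he, Finset.mem_union] at hwA
    rcases hwA with hw | hw
    · exact hwx (hu w hw hwy)
    · exact hwx' (hu' w hw hwy)
  have hIne : S ∩ S' ≠ A := by
    intro he
    exact hUne (Finset.Subset.antisymm (Finset.union_subset hS hS')
      (he ▸ Finset.inter_subset_union))
  have h1 := h.surplus _ (Finset.union_subset hS hS') ⟨x, Finset.mem_union_left _ hxS⟩ hUne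
  have h2 := h.surplus _ (Finset.inter_subset_left.trans hS) hd hIne
  have hyB := h.right_mem hxy
  have hyN : y ∈ relNbrs B R S ∩ relNbrs B R S' :=
    Finset.mem_inter.2 ⟨mem_relNbrs.2 ⟨hyB, x, hxS, hxy⟩, mem_relNbrs.2 ⟨hyB, x', hxS', hxy'⟩⟩
  have hsub : relNbrs B R (S ∩ S') ⊆ (relNbrs B R S ∩ relNbrs B R S').erase y := by
    intro z hz
    obtain ⟨hzB, v, hv, hvz⟩ := mem_relNbrs.1 hz
    rw [Finset.mem_inter] at hv
    rw [Finset.mem_erase, Finset.mem_inter]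
    refine ⟨?_, mem_relNbrs.2 ⟨hzB, v, hv.1, hvz⟩, mem_relNbrs.2 ⟨hzB, v, hv.2, hvz⟩⟩
    rintro rfl
    exact hne ((hu' v hv.2 hvz).symm.trans (hu v hv.1 hvz))
  have h3 := Finset.card_le_card hsub
  rw [Finset.card_erase_of_mem hyN] at h3
  have h4 := Finset.card_pos.2 ⟨y, hyN⟩
  rw [relNbrs_union] at h1
  have h5 := Finset.card_union_add_card_inter (relNbrs B R S) (relNbrs B R S')
  have h6 := Finset.card_union_add_card_inter S S'
  omega

open scoped Classical in
lemma union_tight (h : TightCover A B R) {x : α} {y y' : β} {S S' : Finset α}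
    (hS : S ⊆ A) (hS' : S' ⊆ A) (hxS : x ∈ S) (hxS' : x ∈ S') (hxy : R x y) (hxy' : R x y')
    (hne : y' ≠ y) (hx : 3 ≤ relDeg B R x)
    (hc : (relNbrs B R S).card ≤ S.card + 1) (hc' : (relNbrs B R S').card ≤ S'.card + 1)
    (hu : ∀ z ∈ S, R z y → z = x) (hu' : ∀ z ∈ S', R z y' → z = x) : S ∪ S' = A := by
  by_contra hUne
  have h1 := h.surplus _ (Finset.union_subset hS hS') ⟨x, Finset.mem_union_left _ hxS⟩ hUne
  have hyB := h.right_mem hxy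
  have hyB' := h.right_mem hxy'
  have hxI : x ∈ S ∩ S' := Finset.mem_inter.2 ⟨hxS, hxS'⟩
  have hsub : relNbrs B R (S ∩ S') ⊆ relNbrs B R S ∩ relNbrs B R S' := by
    intro z hz
    obtain ⟨hzB, v, hv, hvz⟩ := mem_relNbrs.1 hz
    rw [Finset.mem_inter] at hv ⊢
    exact ⟨mem_relNbrs.2 ⟨hzB, v, hv.1, hvz⟩, mem_relNbrs.2 ⟨hzB, v, hv.2, hvz⟩⟩
  have h3 := Finset.card_le_card hsub
  have h5 := Finset.card_union_add_card_inter (relNbrs B R S) (relNbrs B R S')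
  have h6 := Finset.card_union_add_card_inter S S'
  rw [relNbrs_union] at h1
  have hsub' : relNbrs B R ((S ∩ S').erase x) ⊆ ((relNbrs B R (S ∩ S')).erase y).erase y' := by
    intro z hz
    obtain ⟨hzB, v, hv, hvz⟩ := mem_relNbrs.1 hz
    rw [Finset.mem_erase] at hv
    have hvI := Finset.mem_inter.1 hv.2
    rw [Finset.mem_erase, Finset.mem_erase]
    refine ⟨?_, ?_, mem_relNbrs.2 ⟨hzB, v, hv.2, hvz⟩⟩
    · rintro rfl
      exact hv.1 (hu' v hvI.2 hvz)
    · rintro rfl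
      exact hv.1 (hu v hvI.1 hvz)
  have h7 := Finset.card_le_card hsub'
  rw [Finset.card_erase_of_mem (Finset.mem_erase.2 ⟨hne, mem_relNbrs.2 ⟨hyB', x, hxI, hxy'⟩⟩),
    Finset.card_erase_of_mem (mem_relNbrs.2 ⟨hyB, x, hxI, hxy⟩)] at h7
  have h8 := Finset.card_erase_of_mem hxI
  have h9 := Finset.card_pos.2 ⟨x, hxI⟩
  by_cases hE : ((S ∩ S').erase x).Nonempty
  · have := h.surplus _ ((Finset.erase_subset _ _).trans (Finset.inter_subset_left.trans hS)) hE
      (fun he => by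
        have := hS hxS
        rw [← he] at this
        simp at this)
    omega
  · rw [Finset.not_nonempty_iff_eq_empty] at hE
    have hI : S ∩ S' = {x} := by
      rw [← Finset.insert_erase hxI, hE]
      rfl
    rw [hI, relNbrs_singleton] at h3
    rw [hI, Finset.card_singleton] at h6
    omega

end TightCover

/-- The relation `R` restricted to pairs of vertices of degree at least `3`. -/
def heavyRel {α β : Type*} (A : Finset α) (B : Finset β) (R : α → β → Prop) (x : α) (y : β) :
    Prop :=
  R x y ∧ 3 ≤ relDeg B R x ∧ 3 ≤ relDeg A (flip R) y

open scoped Classical in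
/-- The elements of `A` with at least three related elements in `B`. -/
noncomputable def heavyPart {α β : Type*} (A : Finset α) (B : Finset β) (R : α → β → Prop) :
    Finset α :=
  A.filter fun x => 3 ≤ relDeg B R x

/-- The edges reached from `(a, b)` along non-backtracking paths leaving through `b`; the flag is
`true` when the edge is traversed from `α` to `β`. -/
inductive ChainReach {α β : Type*} (H : α → β → Prop) (a : α) (b : β) : Bool → α → β → Prop
  | base : ChainReach H a b true a b
  | left {x x' : α} {y : β} : ChainReach H a b true x y → H x' y → x' ≠ x →
      ChainReach H a b false x' y
  | right {x : α} {y y' : β} : ChainReach H a b false x y → H x y' → y' ≠ y →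
      ChainReach H a b true x y'

lemma flip_heavyRel {α β : Type*} {A : Finset α} {B : Finset β} {R : α → β → Prop} :
    flip (heavyRel A B R) = heavyRel B A (flip R) := by
  funext y x
  simp only [flip, heavyRel, eq_iff_iff]
  exact and_congr_right fun _ => and_comm

lemma mem_heavyPart {α β : Type*} {A : Finset α} {B : Finset β} {R : α → β → Prop} {x : α} :
    x ∈ heavyPart A B R ↔ x ∈ A ∧ 3 ≤ relDeg B R x := by
  simp [heavyPart]

namespace TightCover

variable {α β : Type*} {A : Finset α} {B : Finset β} {R : α → β → Prop}

open scoped Classical in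
lemma exists_tight_family (h : TightCover A B R) : ∃ σ : α → β → Finset α,
    (∀ x y, heavyRel A B R x y → σ x y ⊆ A ∧ x ∈ σ x y ∧
      (relNbrs B R (σ x y)).card ≤ (σ x y).card + 1 ∧ ∀ z ∈ σ x y, R z y → z = x) ∧
    (∀ x x' y, heavyRel A B R x y → heavyRel A B R x' y → x' ≠ x →
      Disjoint (σ x y) (σ x' y)) ∧
    (∀ x y y', heavyRel A B R x y → heavyRel A B R x y' → y' ≠ y → σ x y ∪ σ x y' = A) := by
  have hex : ∀ x y, ∃ S : Finset α, heavyRel A B R x y → S ⊆ A ∧ x ∈ S ∧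
      (relNbrs B R S).card ≤ S.card + 1 ∧ ∀ z ∈ S, R z y → z = x := by
    intro x y
    by_cases hxy : heavyRel A B R x y
    · obtain ⟨S, hS⟩ := h.tight x y hxy.1 hxy.2.1 hxy.2.2
      exact ⟨S, fun _ => hS⟩
    · exact ⟨∅, fun hh => absurd hh hxy⟩
  choose σ hσ using hex
  refine ⟨σ, hσ, ?_, ?_⟩
  · intro x x' y hxy hxy' hne
    obtain ⟨h1, h2, h3, h4⟩ := hσ x y hxy
    obtain ⟨h1', h2', h3', h4'⟩ := hσ x' y hxy'
    exact h.disjoint_tight h1 h1' h2 h2' hxy.1 hxy'.1 hne hxy.2.2 h3 h3' h4 h4'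
  · intro x y y' hxy hxy' hne
    obtain ⟨h1, h2, h3, h4⟩ := hσ x y hxy
    obtain ⟨h1', h2', h3', h4'⟩ := hσ x y' hxy'
    exact h.union_tight h1 h1' h2 h2' hxy.1 hxy'.1 hne hxy.2.1 h3 h3' h4 h4'

lemma exists_relDeg_le_one (h : TightCover A B R) (C : Finset α) (D : Finset β)
    (hne : C.Nonempty ∨ D.Nonempty) :
    (∃ x ∈ C, relDeg D (heavyRel A B R) x ≤ 1) ∨
      ∃ y ∈ D, relDeg C (flip (heavyRel A B R)) y ≤ 1 := by
  classical
  by_contra! hcon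
  obtain ⟨hC, hD⟩ := hcon
  obtain ⟨σ, hσ, hdis, hun⟩ := h.exists_tight_family
  have hP : (relPairs C D (heavyRel A B R)).Nonempty := by
    rcases hne with ⟨x, hx⟩ | ⟨y, hy⟩
    · obtain ⟨y, hy, hxy⟩ := Finset.card_pos.1 (Nat.zero_lt_of_lt (hC x hx)) |>.imp
        fun y hy => Finset.mem_filter.1 hy
      exact ⟨(x, y), mem_relPairs.2 ⟨⟨hx, hy⟩, hxy⟩⟩
    · obtain ⟨x, hx, hxy⟩ := Finset.card_pos.1 (Nat.zero_lt_of_lt (hD y hy)) |>.imp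
        fun x hx => Finset.mem_filter.1 hx
      exact ⟨(x, y), mem_relPairs.2 ⟨⟨hx, hy⟩, hxy⟩⟩
  obtain ⟨⟨x, y⟩, hp, hmax⟩ := Finset.exists_max_image _ (fun p => (σ p.1 p.2).card) hP
  obtain ⟨⟨hx, hy⟩, hxy⟩ := mem_relPairs.1 hp
  obtain ⟨x', hx', hxy', hxne⟩ := exists_ne_of_relDeg x (hD y hy)
  obtain ⟨y', hy', hxy₂, hyne⟩ := exists_ne_of_relDeg y (hC x' hx')
  have h1 := hdis x x' y hxy hxy' hxne
  have h2 := hun x' y y' hxy' hxy₂ hyne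
  have h3 : σ x y ⊂ σ x' y' := by
    refine (Finset.ssubset_iff_of_subset fun z hz => ?_).2 ⟨x', (hσ _ _ hxy₂).2.1, ?_⟩
    · have : z ∈ σ x' y ∪ σ x' y' := h2 ▸ (hσ _ _ hxy).1 hz
      exact (Finset.mem_union.1 this).resolve_left (Finset.disjoint_left.1 h1 hz)
    · exact fun hmem => Finset.disjoint_left.1 h1 hmem (hσ _ _ hxy').2.1
  have h4 := Finset.card_lt_card h3
  have h5 := hmax (x', y') (mem_relPairs.2 ⟨⟨hx', hy'⟩, hxy₂⟩)
  simp only at h5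
  omega

lemma card_heavyRel_add_one_le (h : TightCover A B R) (C : Finset α) (D : Finset β)
    (hne : C.Nonempty ∨ D.Nonempty) :
    (relPairs C D (heavyRel A B R)).card + 1 ≤ C.card + D.card := by
  classical
  induction hn : C.card + D.card generalizing C D with
  | zero =>
    rcases hne with h1 | h1 <;> have := h1.card_pos <;> omega
  | succ n ih =>
    rcases h.exists_relDeg_le_one C D hne with ⟨x, hx, hdeg⟩ | ⟨y, hy, hdeg⟩
    · have hsplit := Finset.sum_erase_add C (fun x => relDeg D (heavyRel A B R) x) hx
      rw [← card_relPairs, ← card_relPairs] at hsplit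
      have hce := Finset.card_erase_of_mem hx
      have hcp := Finset.card_pos.2 ⟨x, hx⟩
      by_cases hne' : (C.erase x).Nonempty ∨ D.Nonempty
      · have := ih (C.erase x) D hne' (by omega)
        omega
      · push Not at hne'
        rw [hne'.1, hne'.2]  at hsplit
        simp [relPairs, relDeg] at hsplit
        rw [hne'.2]
        simp [relPairs]
    · have hsplit := Finset.sum_erase_add D (fun y => relDeg C (flip (heavyRel A B R)) y) hy
      rw [← card_relPairs', ← card_relPairs'] at hsplit
      have hce := Finset.card_erase_of_mem hy
      have hcp := Finset.card_pos.2 ⟨y, hy⟩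
      by_cases hne' : C.Nonempty ∨ (D.erase y).Nonempty
      · have := ih C (D.erase y) hne' (by omega)
        omega
      · push Not at hne'
        rw [hne'.1]
        simp [relPairs]

lemma exists_heavy_of_tight (h : TightCover A B R) (hA : 2 ≤ A.card) {a : α} {b : β}
    {S : Finset α} (hab : heavyRel A B R a b) (hS : S ⊆ A) (haS : a ∈ S)
    (hc : (relNbrs B R S).card ≤ S.card + 1) (hu : ∀ z ∈ S, R z b → z = a) :
    ∃ y ∈ relNbrs B R S, y ≠ b ∧ 3 ≤ relDeg A (flip R) y := by
  classical
  by_contra! hcon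
  have hbN : b ∈ relNbrs B R S := mem_relNbrs.2 ⟨h.right_mem hab.1, a, haS, hab.1⟩
  set T := (relNbrs B R S).erase b with hT
  have hTB : T ⊆ B := (Finset.erase_subset _ _).trans relNbrs_subset
  have hSne : S ≠ A := by
    rintro rfl
    obtain ⟨z, hz, hzy, hne⟩ := exists_ne_of_relDeg a (le_trans (by norm_num) hab.2.2)
    exact hne (hu z hz hzy)
  have hsur := h.surplus S hS ⟨a, haS⟩ hSne
  have hTc : T.card = S.card := by
    rw [hT, Finset.card_erase_of_mem hbN]
    omega
  have hSpos := Finset.card_pos.2 ⟨a, haS⟩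
  have hTb : T ≠ B := by
    intro he
    have := h.right_mem hab.1
    rw [← he, hT] at this
    simp at this
  have hTsur := h.surplus_flip T hTB (Finset.card_pos.1 (by omega)) hTb
  have hTdeg : ∑ y ∈ T, relDeg A (flip R) y ≤ T.card * 2 := by
    refine Finset.sum_le_card_nsmul _ _ _ fun y hy => ?_
    rw [hT, Finset.mem_erase] at hy
    have := hcon y hy.2 hy.1
    omega
  have hSdeg : S.card * 2 + 1 ≤ ∑ x ∈ S, relDeg B R x := by
    rw [← Finset.sum_erase_add S _ haS]
    have h1 : (S.erase a).card * 2 ≤ ∑ x ∈ S.erase a, relDeg B R x :=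
      Finset.card_nsmul_le_sum _ _ _ fun x hx =>
        h.two_le_relDeg hA (hS (Finset.mem_of_mem_erase hx))
    rw [Finset.card_erase_of_mem haS] at h1
    have h2 := hab.2.1
    omega
  rw [← card_relPairs] at hSdeg
  rw [← card_relPairs'] at hTdeg
  obtain ⟨x, hx, hxS⟩ : ∃ x ∈ relNbrs A (flip R) T, x ∉ S := by
    by_contra! hsub
    have := Finset.card_le_card (s := relNbrs A (flip R) T) (t := S) hsub
    omega
  obtain ⟨hxA, y, hyT, hxy⟩ := mem_relNbrs.1 hx
  have hsub : insert (x, y) ((relPairs S B R).erase (a, b)) ⊆ relPairs A T R := by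
    intro p hp
    rw [Finset.mem_insert, Finset.mem_erase] at hp
    rcases hp with rfl | ⟨hne, hp⟩
    · exact mem_relPairs.2 ⟨⟨hxA, hyT⟩, hxy⟩
    · obtain ⟨⟨h1, h2⟩, h3⟩ := mem_relPairs.1 hp
      refine mem_relPairs.2 ⟨⟨hS h1, Finset.mem_erase.2 ⟨?_, mem_relNbrs.2 ⟨h2, _, h1, h3⟩⟩⟩, h3⟩
      intro he
      rw [he] at h3
      exact hne (Prod.ext (hu _ h1 h3) he)
  have hcard := Finset.card_le_card hsub
  rw [Finset.card_insert_of_notMem, Finset.card_erase_of_mem] at hcard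
  · omega
  · exact mem_relPairs.2 ⟨⟨haS, h.right_mem hab.1⟩, hab.1⟩
  · intro hmem
    exact hxS (mem_relPairs.1 (Finset.mem_of_mem_erase hmem)).1.1

lemma card_heavyRel_add_two_le_of_leaf (h : TightCover A B R) (hA : 2 ≤ A.card) {a : α} {b : β}
    (hab : heavyRel A B R a b) (hleaf : ∀ y, heavyRel A B R a y → y = b) :
    (relPairs A B (heavyRel A B R)).card + 2 ≤
      (heavyPart A B R).card + (heavyPart B A (flip R)).card := by
  classical
  obtain ⟨σ, hσ, hdis, hun⟩ := h.exists_tight_family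
  obtain ⟨hS, haS, hc, hu⟩ := hσ a b hab
  have key : ∀ i x y, ChainReach (heavyRel A B R) a b i x y → heavyRel A B R x y ∧
      (i = true → σ a b ⊆ σ x y ∧ (y = b ∨ x ∉ σ a b)) ∧
      (i = false → Disjoint (σ a b) (σ x y)) := by
    intro i x y hr
    induction hr with
    | base => exact ⟨hab, by simp, by simp⟩
    | @left x x' y _ hH hne ih =>
      obtain ⟨h1, h2, -⟩ := ih
      refine ⟨hH, by simp, fun _ => ?_⟩
      exact (hdis x x' y h1 hH hne).mono_left (h2 rfl).1
    | @right x y y' _ hH hne ih =>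
      obtain ⟨h1, -, h2⟩ := ih
      refine ⟨hH, fun _ => ⟨fun z hz => ?_, Or.inr fun hx => ?_⟩, by simp⟩
      · have : z ∈ σ x y ∪ σ x y' := hun x y y' h1 hH hne ▸ hS hz
        exact (Finset.mem_union.1 this).resolve_left (Finset.disjoint_left.1 (h2 rfl) hz)
      · exact Finset.disjoint_left.1 (h2 rfl) hx (hσ _ _ h1).2.1
  set A₃ := heavyPart A B R with hA₃
  set B₃ := heavyPart B A (flip R) with hB₃
  set C := A₃.filter fun x => x = a ∨ ∃ y, ChainReach (heavyRel A B R) a b false x y with hC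
  set D := B₃.filter fun y => ∃ x, ChainReach (heavyRel A B R) a b true x y with hD
  have haC : a ∈ C :=
    Finset.mem_filter.2 ⟨mem_heavyPart.2 ⟨h.left_mem hab.1, hab.2.1⟩, Or.inl rfl⟩
  obtain ⟨w, hwN, hwb, hw3⟩ := h.exists_heavy_of_tight hA hab hS haS hc hu
  obtain ⟨hwB, v, hvS, hvw⟩ := mem_relNbrs.1 hwN
  have hwD : w ∈ B₃ \ D := by
    rw [Finset.mem_sdiff]
    refine ⟨mem_heavyPart.2 ⟨hwB, hw3⟩, fun hwD => ?_⟩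
    obtain ⟨-, x, hx⟩ := Finset.mem_filter.1 hwD
    obtain ⟨h1, h2, -⟩ := key _ _ _ hx
    obtain ⟨h3, h4⟩ := h2 rfl
    have := (hσ _ _ h1).2.2.2 v (h3 hvS) hvw
    subst this
    exact h4.elim hwb (fun h5 => h5 hvS)
  have hstep : ∀ x y, heavyRel A B R x y → (x ∈ C ↔ y ∈ D) := by
    intro x y hxy
    have hx3 : x ∈ A₃ := mem_heavyPart.2 ⟨h.left_mem hxy.1, hxy.2.1⟩
    have hy3 : y ∈ B₃ := mem_heavyPart.2 ⟨h.right_mem hxy.1, hxy.2.2⟩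
    rw [hC, hD, Finset.mem_filter, Finset.mem_filter]
    simp only [hx3, hy3, true_and]
    constructor
    · rintro (rfl | ⟨y₀, hy₀⟩)
      · obtain rfl := hleaf y hxy
        exact ⟨_, .base⟩
      · by_cases hy : y = y₀
        · subst hy
          cases hy₀ with
          | left hr _ _ => exact ⟨_, hr⟩
        · exact ⟨x, .right hy₀ hxy hy⟩
    · rintro ⟨x₀, hx₀⟩
      by_cases hx : x = x₀
      · subst hx
        cases hx₀ with
        | base => exact Or.inl rfl
        | right hr _ _ => exact Or.inr ⟨_, hr⟩
      · exact Or.inr ⟨y, .left hx₀ hxy hx⟩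
  have h1 := h.card_heavyRel_add_one_le C D (Or.inl ⟨a, haC⟩)
  have h2 := h.card_heavyRel_add_one_le (A₃ \ C) (B₃ \ D) (Or.inr ⟨w, hwD⟩)
  have hsub : relPairs A B (heavyRel A B R) ⊆ relPairs C D (heavyRel A B R) ∪
      relPairs (A₃ \ C) (B₃ \ D) (heavyRel A B R) := by
    rintro ⟨x, y⟩ hp
    obtain ⟨⟨hx, hy⟩, hxy⟩ := mem_relPairs.1 hp
    simp only at hx hy hxy
    have hx3 : x ∈ A₃ := mem_heavyPart.2 ⟨hx, hxy.2.1⟩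
    have hy3 : y ∈ B₃ := mem_heavyPart.2 ⟨hy, hxy.2.2⟩
    have := hstep x y hxy
    simp only [Finset.mem_union, mem_relPairs, Finset.mem_sdiff, hx3, hy3, hxy, true_and,
      and_true]
    tauto
  have h3 := (Finset.card_le_card hsub).trans (Finset.card_union_le _ _)
  have hCA : C ⊆ A₃ := Finset.filter_subset _ _
  have hDB : D ⊆ B₃ := Finset.filter_subset _ _
  rw [Finset.card_sdiff_of_subset hCA, Finset.card_sdiff_of_subset hDB] at h2
  have h4 := Finset.card_le_card hCA
  have h5 := Finset.card_le_card hDB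
  omega

lemma exists_heavy_left (h : TightCover A B R) (hA : 2 ≤ A.card)
    (hB : (heavyPart B A (flip R)).Nonempty) : (heavyPart A B R).Nonempty := by
  classical
  by_contra hcon
  obtain ⟨y, hy⟩ := hB
  obtain ⟨hyB, hy3⟩ := mem_heavyPart.1 hy
  have hc := h.card_eq
  have h1 : ∑ x ∈ A, relDeg B R x ≤ A.card * 2 := by
    refine Finset.sum_le_card_nsmul _ _ _ fun x hx => ?_
    by_contra hlt
    exact hcon ⟨x, mem_heavyPart.2 ⟨hx, by omega⟩⟩
  have h2 : B.card * 2 < ∑ y ∈ B, relDeg A (flip R) y := by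
    rw [← smul_eq_mul, ← Finset.sum_const]
    refine Finset.sum_lt_sum (fun z hz => ?_) ⟨y, hyB, by omega⟩
    exact h.symm.two_le_relDeg (by omega) hz
  rw [← card_relPairs] at h1
  rw [← card_relPairs'] at h2
  omega

/-- The edges between vertices of degree at least `3` form a forest with at least two
components. -/
lemma card_heavyRel_add_two_le (h : TightCover A B R) (hA : 2 ≤ A.card)
    (hB : (heavyPart B A (flip R)).Nonempty) :
    (relPairs A B (heavyRel A B R)).card + 2 ≤
      (heavyPart A B R).card + (heavyPart B A (flip R)).card := by
  classical
  by_cases hE : (relPairs A B (heavyRel A B R)).Nonempty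
  · obtain ⟨⟨x₀, y₀⟩, hp⟩ := hE
    obtain ⟨⟨hx₀, hy₀⟩, hxy₀⟩ := mem_relPairs.1 hp
    simp only at hx₀ hy₀ hxy₀
    have hleaf := h.exists_relDeg_le_one (A.filter fun x => ∃ y, heavyRel A B R x y)
      (B.filter fun y => ∃ x, heavyRel A B R x y)
      (Or.inl ⟨x₀, Finset.mem_filter.2 ⟨hx₀, y₀, hxy₀⟩⟩)
    rcases hleaf with ⟨x, hx, hdeg⟩ | ⟨y, hy, hdeg⟩
    · obtain ⟨-, b, hb⟩ := Finset.mem_filter.1 hx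
      refine h.card_heavyRel_add_two_le_of_leaf hA hb fun y hy => ?_
      exact Finset.card_le_one.1 hdeg y
        (Finset.mem_filter.2 ⟨Finset.mem_filter.2 ⟨h.right_mem hy.1, x, hy⟩, hy⟩) b
        (Finset.mem_filter.2 ⟨Finset.mem_filter.2 ⟨h.right_mem hb.1, x, hb⟩, hb⟩)
    · obtain ⟨-, a, ha⟩ := Finset.mem_filter.1 hy
      have ha' : heavyRel B A (flip R) y a := by
        rw [← flip_heavyRel]
        exact ha
      have := h.symm.card_heavyRel_add_two_le_of_leaf (h.card_eq ▸ hA) ha' fun x hx => by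
        rw [← flip_heavyRel] at hx
        change heavyRel A B R x y at hx
        exact Finset.card_le_one.1 hdeg x
          (Finset.mem_filter.2 ⟨Finset.mem_filter.2 ⟨h.left_mem hx.1, y, hx⟩, hx⟩) a
          (Finset.mem_filter.2 ⟨Finset.mem_filter.2 ⟨h.left_mem ha.1, y, ha⟩, ha⟩)
      rw [← flip_heavyRel, card_relPairs_flip, add_comm (Finset.card (heavyPart _ _ _))] at this
      exact this
  · rw [Finset.not_nonempty_iff_eq_empty] at hE
    rw [hE, Finset.card_empty]
    have h1 := (h.exists_heavy_left hA hB).card_pos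
    have h2 := hB.card_pos
    omega

end TightCover

/-- The relation `R` restricted to pairs with a vertex of degree at least `3`. -/
def semiheavyRel {α β : Type*} (A : Finset α) (B : Finset β) (R : α → β → Prop) (x : α) (y : β) :
    Prop :=
  R x y ∧ (3 ≤ relDeg B R x ∨ 3 ≤ relDeg A (flip R) y)

/-- The relation obtained by deleting `a` and merging `b'` into `b`. -/
def contractRel {α β : Type*} (R : α → β → Prop) (a : α) (b b' : β) (x : α) (y : β) : Prop :=
  x ≠ a ∧ y ≠ b' ∧ (R x y ∨ (y = b ∧ R x b'))

lemma flip_semiheavyRel {α β : Type*} {A : Finset α} {B : Finset β} {R : α → β → Prop} :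
    flip (semiheavyRel A B R) = semiheavyRel B A (flip R) := by
  funext y x
  simp only [flip, semiheavyRel, eq_iff_iff]
  exact and_congr_right fun _ => or_comm

namespace TightCover

variable {α β : Type*} {A : Finset α} {B : Finset β} {R : α → β → Prop} {a : α} {b b' : β}

lemma not_mem_both (h : TightCover A B R) (ha : ∀ y, R a y ↔ y = b ∨ y = b') {S : Finset α}
    {w : α} (hS : S ⊆ A) (haS : a ∉ S) (hc : (relNbrs B R S).card ≤ S.card + 1)
    (hwA : w ∈ A) (hwS : w ∉ S) (hwa : w ≠ a) (hb : b ∈ relNbrs B R S)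
    (hb' : b' ∈ relNbrs B R S) : False := by
  classical
  have haA : a ∈ A := h.left_mem ((ha b).2 (Or.inl rfl))
  have h1 := h.surplus (insert a S) (Finset.insert_subset haA hS) (Finset.insert_nonempty _ _)
    (fun he => by
      rw [← he, Finset.mem_insert] at hwA
      exact hwA.elim hwa hwS)
  have h2 : relNbrs B R (insert a S) ⊆ relNbrs B R S := by
    intro y hy
    obtain ⟨hyB, x, hx, hxy⟩ := mem_relNbrs.1 hy
    rcases Finset.mem_insert.1 hx with rfl | hx
    · rcases (ha y).1 hxy with rfl | rfl
      · exact hb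
      · exact hb'
    · exact mem_relNbrs.2 ⟨hyB, x, hx, hxy⟩
  have h3 := Finset.card_le_card h2
  rw [Finset.card_insert_of_notMem haS] at h1
  omega

lemma not_common (h : TightCover A B R) (ha : ∀ y, R a y ↔ y = b ∨ y = b') (hbb : b ≠ b')
    (hb : 3 ≤ relDeg A (flip R) b) {x : α} (hxa : x ≠ a)
    (hxb : R x b) (hxb' : R x b') : False := by
  classical
  have haA : a ∈ A := h.left_mem ((ha b).2 (Or.inl rfl))
  have hxA : x ∈ A := h.left_mem hxb
  by_cases hx : 3 ≤ relDeg B R x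
  · obtain ⟨S, hSA, hxS, hc, hu⟩ := h.tight x b hxb hx hb
    have haS : a ∉ S := fun haS => hxa (hu a haS ((ha b).2 (Or.inl rfl))).symm
    obtain ⟨w, hwA, hwb, hwx, hwa⟩ := exists_ne_ne_of_relDeg x a hb
    exact h.not_mem_both ha hSA haS hc hwA (fun hwS => hwx (hu w hwS hwb)) hwa
      (mem_relNbrs.2 ⟨h.right_mem hxb, x, hxS, hxb⟩)
      (mem_relNbrs.2 ⟨h.right_mem hxb', x, hxS, hxb'⟩)
  · have hsub : relNbrs B R {a, x} ⊆ {b, b'} := by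
      intro y hy
      obtain ⟨hyB, z, hz, hzy⟩ := mem_relNbrs.1 hy
      rw [Finset.mem_insert, Finset.mem_singleton] at hz ⊢
      rcases hz with rfl | rfl
      · exact (ha y).1 hzy
      · by_contra! hne
        refine hx ?_
        have h3 : ({b, b', y} : Finset β) ⊆ B.filter fun y => R z y := by
          intro w hw
          simp only [Finset.mem_insert, Finset.mem_singleton] at hw
          rw [Finset.mem_filter]
          rcases hw with rfl | rfl | rfl
          · exact ⟨h.right_mem hxb, hxb⟩
          · exact ⟨h.right_mem hxb', hxb'⟩
          · exact ⟨hyB, hzy⟩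
        have h4 := Finset.card_le_card h3
        rwa [Finset.card_eq_three.2 ⟨b, b', y, hbb, hne.1.symm, hne.2.symm, rfl⟩] at h4
    obtain ⟨w, hwA, hwb, hwx, hwa⟩ := exists_ne_ne_of_relDeg x a hb
    have h1 := h.surplus {a, x} (by simp [Finset.insert_subset_iff, haA, hxA])
      (Finset.insert_nonempty _ _) (fun he => by
        rw [← he] at hwA
        simp [hwx, hwa] at hwA)
    have h2 := Finset.card_le_card hsub
    rw [Finset.card_pair hbb] at h2
    rw [Finset.card_pair hxa.symm] at h1
    omega

open scoped Classical in
lemma relDeg_contractRel_left (h : TightCover A B R) (ha : ∀ y, R a y ↔ y = b ∨ y = b')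
    (hbb : b ≠ b') (hb : 3 ≤ relDeg A (flip R) b) {x : α} (hxa : x ≠ a) :
    relDeg (B.erase b') (contractRel R a b b') x = relDeg B R x := by
  have hbB : b ∈ B := h.right_mem ((ha b).2 (Or.inl rfl))
  unfold relDeg
  rw [← Finset.card_image_of_injOn (s := B.filter fun y => R x y)
    (f := fun y => if y = b' then b else y)]
  · congr 1
    ext y
    rw [Finset.mem_filter, Finset.mem_erase, Finset.mem_image]
    simp only [Finset.mem_filter, contractRel]
    constructor
    · rintro ⟨⟨h1, h2⟩, -, -, h3 | ⟨rfl, h3⟩⟩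
      · exact ⟨y, ⟨h2, h3⟩, by simp [h1]⟩
      · exact ⟨b', ⟨h.right_mem h3, h3⟩, by simp⟩
    · rintro ⟨z, ⟨hzB, hz⟩, rfl⟩
      by_cases hzb : z = b'
      · subst hzb
        simp [hbb, hbB, hxa, hz]
      · simp [hzb, hzB, hxa, hz]
  · intro y hy z hz hyz
    have hy' := (Finset.mem_filter.1 hy).2
    have hz' := (Finset.mem_filter.1 hz).2
    by_cases h1 : y = b' <;> by_cases h2 : z = b' <;> simp only [h1, h2, if_true, if_false] at hyz
    · rw [h1, h2]
    · subst h1 hyz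
      exact (h.not_common ha hbb hb hxa hz' hy').elim
    · subst h2 hyz
      exact (h.not_common ha hbb hb hxa hy' hz').elim
    · exact hyz

open scoped Classical in
lemma relDeg_contractRel_right (ha : ∀ y, R a y ↔ y = b ∨ y = b') {y : β} (hyb : y ≠ b)
    (hyb' : y ≠ b') :
    relDeg (A.erase a) (flip (contractRel R a b b')) y = relDeg A (flip R) y := by
  unfold relDeg
  congr 1
  ext x
  rw [Finset.mem_filter, Finset.mem_filter, Finset.mem_erase]
  simp only [flip, contractRel]
  constructor
  · rintro ⟨⟨h1, h2⟩, -, -, h3 | ⟨h3, -⟩⟩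
    · exact ⟨h2, h3⟩
    · exact absurd h3 hyb
  · rintro ⟨h1, h2⟩
    have hxa : x ≠ a := by
      rintro rfl
      exact ((ha y).1 h2).elim hyb hyb'
    exact ⟨⟨hxa, h1⟩, hxa, hyb', Or.inl h2⟩

open scoped Classical in
lemma three_le_relDeg_contractRel (h : TightCover A B R) (ha : ∀ y, R a y ↔ y = b ∨ y = b')
    (hbb : b ≠ b') (hb : 3 ≤ relDeg A (flip R) b) (hb' : 3 ≤ relDeg A (flip R) b') :
    3 ≤ relDeg (A.erase a) (flip (contractRel R a b b')) b := by
  obtain ⟨w, hwA, hwb, hwa⟩ := exists_ne_of_relDeg a (le_trans (by norm_num) hb')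
  have hsub : insert w ((A.filter fun x => flip R b x).erase a) ⊆
      (A.erase a).filter fun x => flip (contractRel R a b b') b x := by
    intro x hx
    rw [Finset.mem_insert, Finset.mem_erase, Finset.mem_filter] at hx
    rw [Finset.mem_filter, Finset.mem_erase]
    rcases hx with rfl | ⟨h1, h2, h3⟩
    · exact ⟨⟨hwa, hwA⟩, hwa, hbb, Or.inr ⟨rfl, hwb⟩⟩
    · exact ⟨⟨h1, h2⟩, h1, hbb, Or.inl h3⟩
  have h1 := Finset.card_le_card hsub
  rw [Finset.card_insert_of_notMem] at h1
  · have h2 := Finset.pred_card_le_card_erase (s := A.filter fun x => flip R b x) (a := a)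
    unfold relDeg at hb ⊢
    omega
  · intro hw
    rw [Finset.mem_erase, Finset.mem_filter] at hw
    exact h.not_common ha hbb hb hwa hw.2.2 hwb

open scoped Classical in
lemma contract (h : TightCover A B R) (ha : ∀ y, R a y ↔ y = b ∨ y = b')
    (hbb : b ≠ b') (hb : 3 ≤ relDeg A (flip R) b) (hb' : 3 ≤ relDeg A (flip R) b') :
    TightCover (A.erase a) (B.erase b') (contractRel R a b b') := by
  have hRb : R a b := (ha b).2 (Or.inl rfl)
  have hRb' : R a b' := (ha b').2 (Or.inr rfl)
  have haA : a ∈ A := h.left_mem hRb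
  have hbB : b ∈ B := h.right_mem hRb
  have hbB' : b' ∈ B := h.right_mem hRb'
  refine ⟨?_, ?_, ?_, ?_, ?_⟩
  · rintro x y ⟨h1, h2, h3 | ⟨-, h3⟩⟩ <;> exact Finset.mem_erase.2 ⟨h1, h.left_mem h3⟩
  · rintro x y ⟨h1, h2, h3 | ⟨rfl, h3⟩⟩
    · exact Finset.mem_erase.2 ⟨h2, h.right_mem h3⟩
    · exact Finset.mem_erase.2 ⟨h2, hbB⟩
  · rw [Finset.card_erase_of_mem haA, Finset.card_erase_of_mem hbB', h.card_eq]
  · intro S hS hSne hSA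
    have haS : a ∉ S := fun hh => by simpa using hS hh
    have hSA' : S ⊆ A := hS.trans (Finset.erase_subset _ _)
    by_cases hmeet : b ∈ relNbrs B R S ∨ b' ∈ relNbrs B R S
    · have h1 := h.surplus (insert a S) (Finset.insert_subset haA hSA')
        (Finset.insert_nonempty _ _) (fun he => hSA (by rw [← he, Finset.erase_insert haS]))
      have h2 : (relNbrs B R (insert a S)).erase b' ⊆
          relNbrs (B.erase b') (contractRel R a b b') S := by
        intro y hy
        obtain ⟨hyb, hy⟩ := Finset.mem_erase.1 hy
        obtain ⟨hyB, x, hx, hxy⟩ := mem_relNbrs.1 hy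
        refine mem_relNbrs.2 ⟨Finset.mem_erase.2 ⟨hyb, hyB⟩, ?_⟩
        rcases Finset.mem_insert.1 hx with rfl | hx
        · obtain rfl := ((ha y).1 hxy).resolve_right hyb
          rcases hmeet with hm | hm <;> obtain ⟨-, z, hz, hzy⟩ := mem_relNbrs.1 hm
          · exact ⟨z, hz, fun he => haS (he ▸ hz), hyb, Or.inl hzy⟩
          · exact ⟨z, hz, fun he => haS (he ▸ hz), hyb, Or.inr ⟨rfl, hzy⟩⟩
        · exact ⟨x, hx, fun he => haS (he ▸ hx), hyb, Or.inl hxy⟩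
      have h3 := Finset.card_le_card h2
      have h4 := Finset.pred_card_le_card_erase (s := relNbrs B R (insert a S)) (a := b')
      rw [Finset.card_insert_of_notMem haS] at h1
      omega
    · push Not at hmeet
      have h1 := h.surplus S hSA' hSne (fun he => haS (he ▸ haA))
      refine h1.trans (Finset.card_le_card fun y hy => ?_)
      obtain ⟨hyB, x, hx, hxy⟩ := mem_relNbrs.1 hy
      have hyb : y ≠ b' := fun he => hmeet.2 (he ▸ hy)
      exact mem_relNbrs.2 ⟨Finset.mem_erase.2 ⟨hyb, hyB⟩, x, hx, fun he => haS (he ▸ hx), hyb,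
        Or.inl hxy⟩
  · rintro x y ⟨hxa, hyb', hR⟩ hx hy
    rw [h.relDeg_contractRel_left ha hbb hb hxa] at hx
    obtain ⟨y₀, hxy₀, hy₀, hyy₀⟩ : ∃ y₀, R x y₀ ∧ 3 ≤ relDeg A (flip R) y₀ ∧
        ((y₀ = y ∧ y ≠ b) ∨ (y = b ∧ (y₀ = b ∨ y₀ = b'))) := by
      by_cases hyb : y = b
      · subst hyb
        rcases hR with hR | ⟨-, hR⟩
        · exact ⟨y, hR, hb, Or.inr ⟨rfl, Or.inl rfl⟩⟩
        · exact ⟨b', hR, hb', Or.inr ⟨rfl, Or.inr rfl⟩⟩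
      · rw [relDeg_contractRel_right ha hyb hyb'] at hy
        exact ⟨y, hR.resolve_right fun hh => hyb hh.1, hy, Or.inl ⟨rfl, hyb⟩⟩
    obtain ⟨S, hSA, hxS, hc, hu⟩ := h.tight x y₀ hxy₀ hx hy₀
    by_cases haS : a ∈ S
    · have hne : y₀ ≠ b ∧ y₀ ≠ b' := by
        constructor <;> rintro rfl
        · exact hxa (hu a haS hRb).symm
        · exact hxa (hu a haS hRb').symm
      obtain ⟨rfl, hyb⟩ : y₀ = y ∧ y ≠ b :=
        hyy₀.resolve_right fun hh => hh.2.elim hne.1 hne.2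
      refine ⟨S.erase a, Finset.erase_subset_erase _ hSA, Finset.mem_erase.2 ⟨hxa, hxS⟩, ?_, ?_⟩
      · have hsub : relNbrs (B.erase b') (contractRel R a b b') (S.erase a) ⊆
            (relNbrs B R S).erase b' := by
          intro z hz
          obtain ⟨hzB, w, hw, hwa, hzb, hwz⟩ := mem_relNbrs.1 hz
          rw [Finset.mem_erase] at hw hzB ⊢
          refine ⟨hzb, mem_relNbrs.2 ⟨hzB.2, ?_⟩⟩
          rcases hwz with hwz | ⟨rfl, -⟩
          · exact ⟨w, hw.2, hwz⟩
          · exact ⟨a, haS, hRb⟩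
        have h1 := Finset.card_le_card hsub
        rw [Finset.card_erase_of_mem (mem_relNbrs.2 ⟨hbB', a, haS, hRb'⟩)] at h1
        have h2 := Finset.card_erase_of_mem haS
        have h3 := Finset.card_pos.2 ⟨a, haS⟩
        omega
      · rintro z hz ⟨-, -, hzy⟩
        exact hu z (Finset.mem_of_mem_erase hz) (hzy.resolve_right fun hh => hyb hh.1)
    · obtain ⟨w, hwA, hwy, hwx, hwa⟩ := exists_ne_ne_of_relDeg x a hy₀
      have hnb := h.not_mem_both ha hSA haS hc hwA (fun hwS => hwx (hu w hwS hwy)) hwa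
      refine ⟨S, fun z hz => Finset.mem_erase.2 ⟨fun he => haS (he ▸ hz), hSA hz⟩, hxS, ?_, ?_⟩
      · refine le_trans ?_ hc
        refine Finset.card_le_card_of_surjOn (fun y => if y = b' then b else y) ?_
        intro z hz
        obtain ⟨hzB, v, hv, hva, hzb, hvz⟩ := mem_relNbrs.1 hz
        rcases hvz with hvz | ⟨rfl, hvz⟩
        · exact ⟨z, mem_relNbrs.2 ⟨h.right_mem hvz, v, hv, hvz⟩, by simp [hzb]⟩
        · exact ⟨b', mem_relNbrs.2 ⟨hbB', v, hv, hvz⟩, by simp⟩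
      · rintro z hz ⟨-, -, hzy⟩
        rcases hyy₀ with ⟨rfl, hyb⟩ | ⟨rfl, rfl | rfl⟩
        · exact hu z hz (hzy.resolve_right fun hh => hyb hh.1)
        · rcases hzy with hzy | ⟨-, hzy⟩
          · exact hu z hz hzy
          · exact (hnb (mem_relNbrs.2 ⟨hbB, x, hxS, hxy₀⟩)
              (mem_relNbrs.2 ⟨hbB', z, hz, hzy⟩)).elim
        · rcases hzy with hzy | ⟨-, hzy⟩
          · exact (hnb (mem_relNbrs.2 ⟨hbB, z, hz, hzy⟩)
              (mem_relNbrs.2 ⟨hbB', x, hxS, hxy₀⟩)).elim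
          · exact hu z hz hzy

open scoped Classical in
lemma card_semiheavyRel_le_contract (h : TightCover A B R) (ha : ∀ y, R a y ↔ y = b ∨ y = b')
    (hbb : b ≠ b') (hb : 3 ≤ relDeg A (flip R) b) (hb' : 3 ≤ relDeg A (flip R) b') :
    (relPairs A B (semiheavyRel A B R)).card ≤ (relPairs (A.erase a) (B.erase b')
      (semiheavyRel (A.erase a) (B.erase b') (contractRel R a b b'))).card + 2 := by
  have hbB : b ∈ B := h.right_mem ((ha b).2 (Or.inl rfl))
  set P := relPairs A B (semiheavyRel A B R)
  have h1 : ((P.erase (a, b)).erase (a, b')).card ≤ (relPairs (A.erase a) (B.erase b')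
      (semiheavyRel (A.erase a) (B.erase b') (contractRel R a b b'))).card := by
    have hmem : ∀ p ∈ (P.erase (a, b)).erase (a, b'), p.1 ≠ a ∧ p.1 ∈ A ∧ p.2 ∈ B ∧
        semiheavyRel A B R p.1 p.2 := by
      rintro ⟨x, y⟩ hp
      rw [Finset.mem_erase, Finset.mem_erase] at hp
      obtain ⟨hp1, hp2, hp3⟩ := hp
      obtain ⟨⟨h3, h4⟩, h5⟩ := mem_relPairs.1 hp3
      refine ⟨?_, h3, h4, h5⟩
      rintro rfl
      rcases (ha y).1 h5.1 with rfl | rfl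
      · exact hp2 rfl
      · exact hp1 rfl
    refine Finset.card_le_card_of_injOn (fun p => (p.1, if p.2 = b' then b else p.2)) ?_ ?_
    · rintro ⟨x, y⟩ hp
      obtain ⟨hxa, hxA, hyB, hR, hdeg⟩ := hmem _ hp
      simp only at hxa hxA hyB hR hdeg
      refine Finset.mem_coe.2 (mem_relPairs.2 ⟨⟨Finset.mem_erase.2 ⟨hxa, hxA⟩, ?_⟩, ?_, ?_⟩)
      · dsimp only
        split_ifs with hy
        · exact Finset.mem_erase.2 ⟨hbb, hbB⟩
        · exact Finset.mem_erase.2 ⟨hy, hyB⟩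
      · simp only
        split_ifs with hy
        · subst hy
          exact ⟨hxa, hbb, Or.inr ⟨rfl, hR⟩⟩
        · exact ⟨hxa, hy, Or.inl hR⟩
      · simp only
        rw [h.relDeg_contractRel_left ha hbb hb hxa]
        refine hdeg.imp id fun hd => ?_
        split_ifs with hy
        · exact h.three_le_relDeg_contractRel ha hbb hb hb'
        · by_cases hyb : y = b
          · rw [hyb]
            exact h.three_le_relDeg_contractRel ha hbb hb hb'
          · rwa [relDeg_contractRel_right ha hyb hy]
    · rintro ⟨x, y⟩ hp ⟨x', y'⟩ hp' heq
      obtain ⟨hxa, -, -, hR, -⟩ := hmem _ hp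
      obtain ⟨-, -, -, hR', -⟩ := hmem _ hp'
      simp only [Prod.mk.injEq] at hxa hR hR' heq
      obtain ⟨rfl, heq⟩ := heq
      by_cases h1 : y = b' <;> by_cases h2 : y' = b' <;>
        simp only [h1, h2, if_true, if_false] at heq
      · rw [h1, h2]
      · subst h1 heq
        exact (h.not_common ha hbb hb hxa hR' hR).elim
      · subst h2 heq
        exact (h.not_common ha hbb hb hxa hR hR').elim
      · rw [heq]
  have h2 := Finset.pred_card_le_card_erase (s := P) (a := (a, b))
  have h3 := Finset.pred_card_le_card_erase (s := P.erase (a, b)) (a := (a, b'))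
  omega

open scoped Classical in
lemma exists_contract (h : TightCover A B R) {x : α} {y y' : β} (hx : ¬ 3 ≤ relDeg B R x)
    (hxy : R x y) (hxy' : R x y') (hne : y ≠ y') (hy : 3 ≤ relDeg A (flip R) y)
    (hy₂ : 3 ≤ relDeg A (flip R) y') :
    ∃ (A' : Finset α) (B' : Finset β) (R' : α → β → Prop), TightCover A' B' R' ∧
      A'.card + 1 = A.card ∧ (heavyPart B' A' (flip R')).Nonempty ∧
      (relPairs A B (semiheavyRel A B R)).card ≤
        (relPairs A' B' (semiheavyRel A' B' R')).card + 2 := by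
  have ha : ∀ z, R x z ↔ z = y ∨ z = y' := by
    intro z
    constructor
    · intro hz
      by_contra! hzn
      refine hx ?_
      have h3 : ({y, y', z} : Finset β) ⊆ B.filter fun y => R x y := by
        intro w hw
        simp only [Finset.mem_insert, Finset.mem_singleton] at hw
        rw [Finset.mem_filter]
        rcases hw with rfl | rfl | rfl
        · exact ⟨h.right_mem hxy, hxy⟩
        · exact ⟨h.right_mem hxy', hxy'⟩
        · exact ⟨h.right_mem hz, hz⟩
      have h4 := Finset.card_le_card h3
      rwa [Finset.card_eq_three.2 ⟨y, y', z, hne, hzn.1.symm, hzn.2.symm, rfl⟩] at h4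
    · rintro (rfl | rfl) <;> assumption
  refine ⟨_, _, _, h.contract ha hne hy hy₂, ?_, ⟨y, ?_⟩,
    h.card_semiheavyRel_le_contract ha hne hy hy₂⟩
  · exact Finset.card_erase_add_one (h.left_mem hxy)
  · exact mem_heavyPart.2 ⟨Finset.mem_erase.2 ⟨hne, h.right_mem hxy⟩,
      (h.three_le_relDeg_contractRel ha hne hy hy₂)⟩

/-- The edges with an endpoint of degree at least `3` number at most the number of vertices
minus `2`. -/
lemma card_semiheavyRel_add_two_le (h : TightCover A B R)
    (hB : (heavyPart B A (flip R)).Nonempty) :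
    (relPairs A B (semiheavyRel A B R)).card + 2 ≤ A.card + B.card := by
  classical
  induction hn : A.card using Nat.strong_induction_on generalizing A B R with
  | _ n ih =>
  have hA : 2 ≤ A.card := by
    obtain ⟨y, hy⟩ := hB
    have := (mem_heavyPart.1 hy).2.trans (Finset.card_filter_le _ _)
    omega
  have hce := h.card_eq
  by_cases h1 : ∃ x y y', ¬ 3 ≤ relDeg B R x ∧ R x y ∧ R x y' ∧ y ≠ y' ∧
      3 ≤ relDeg A (flip R) y ∧ 3 ≤ relDeg A (flip R) y'
  · obtain ⟨x, y, y', hx, hxy, hxy', hne, hy, hy'⟩ := h1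
    obtain ⟨A', B', R', h', hA', hB', hle⟩ := h.exists_contract hx hxy hxy' hne hy hy'
    have := ih A'.card (by omega) h' hB' rfl
    have := h'.card_eq
    omega
  by_cases h2 : ∃ y x x', ¬ 3 ≤ relDeg A (flip R) y ∧ R x y ∧ R x' y ∧ x ≠ x' ∧
      3 ≤ relDeg B R x ∧ 3 ≤ relDeg B R x'
  · obtain ⟨y, x, x', hy, hxy, hxy', hne, hx, hx'⟩ := h2
    obtain ⟨B', A', R', h', hB', hA', hle⟩ :=
      h.symm.exists_contract hy (y := x) (y' := x') hxy hxy' hne hx hx'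
    have hce' := h'.card_eq
    have := ih A'.card (by omega) h'.symm (h'.exists_heavy_left (by
      obtain ⟨z, hz⟩ := hA'
      have := (mem_heavyPart.1 hz).2.trans (Finset.card_filter_le _ _)
      omega) hA') rfl
    rw [← flip_semiheavyRel, card_relPairs_flip] at hle this
    omega
  push Not at h1 h2
  have hsub : relPairs A B (semiheavyRel A B R) ⊆ relPairs A B (heavyRel A B R) ∪
      ((relPairs A B fun x y => R x y ∧ ¬ 3 ≤ relDeg B R x ∧ 3 ≤ relDeg A (flip R) y) ∪
        relPairs A B fun x y => R x y ∧ 3 ≤ relDeg B R x ∧ ¬ 3 ≤ relDeg A (flip R) y) := by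
    intro p hp
    simp only [Finset.mem_union, mem_relPairs, semiheavyRel, heavyRel] at hp ⊢
    tauto
  have h3 := (Finset.card_le_card hsub).trans ((Finset.card_union_le _ _).trans
    (Nat.add_le_add_left (Finset.card_union_le _ _) _))
  have h4 : (relPairs A B fun x y => R x y ∧ ¬ 3 ≤ relDeg B R x ∧
      3 ≤ relDeg A (flip R) y).card ≤ (A.filter fun x => ¬ 3 ≤ relDeg B R x).card := by
    refine Finset.card_le_card_of_injOn Prod.fst ?_ ?_
    · intro p hp
      obtain ⟨⟨hp1, hp2⟩, hp3⟩ := mem_relPairs.1 hp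
      exact Finset.mem_coe.2 (Finset.mem_filter.2 ⟨hp1, hp3.2.1⟩)
    · rintro ⟨x, y⟩ hp ⟨x', y'⟩ hp' (rfl : x = x')
      obtain ⟨-, hp3⟩ := mem_relPairs.1 hp
      obtain ⟨-, hp4⟩ := mem_relPairs.1 hp'
      simp only at hp3 hp4
      by_contra hne
      have := h1 x y y' (by omega) hp3.1 hp4.1 (fun he => hne (by rw [he])) hp3.2.2
      omega
  have h5 : (relPairs A B fun x y => R x y ∧ 3 ≤ relDeg B R x ∧
      ¬ 3 ≤ relDeg A (flip R) y).card ≤ (B.filter fun y => ¬ 3 ≤ relDeg A (flip R) y).card := by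
    refine Finset.card_le_card_of_injOn Prod.snd ?_ ?_
    · intro p hp
      obtain ⟨⟨hp1, hp2⟩, hp3⟩ := mem_relPairs.1 hp
      exact Finset.mem_coe.2 (Finset.mem_filter.2 ⟨hp2, hp3.2.2⟩)
    · rintro ⟨x, y⟩ hp ⟨x', y'⟩ hp' (rfl : y = y')
      obtain ⟨-, hp3⟩ := mem_relPairs.1 hp
      obtain ⟨-, hp4⟩ := mem_relPairs.1 hp'
      simp only at hp3 hp4
      by_contra hne
      have := h2 y x x' (by omega) hp3.1 hp4.1 (fun he => hne (by rw [he])) hp3.2.1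
      omega
  have h6 := h.card_heavyRel_add_two_le hA hB
  have h7 := Finset.card_filter_add_card_filter_not (s := A) (fun x => 3 ≤ relDeg B R x)
  have h8 := Finset.card_filter_add_card_filter_not (s := B)
    (fun y => 3 ≤ relDeg A (flip R) y)
  unfold heavyPart at h6
  omega

end TightCover

/-- `A` is one side of a bipartition of `G`. -/
def IsSide {V : Type*} (G : SimpleGraph V) (A : Finset V) : Prop :=
  ∀ u v, G.Adj u v → (u ∈ A ↔ v ∉ A)

/-- Adjacency in `G`, restricted to pairs whose first entry lies in `A`. -/
def sideRel {V : Type*} (G : SimpleGraph V) (A : Finset V) (x y : V) : Prop :=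
  G.Adj x y ∧ x ∈ A

lemma exists_injective_of_isPerfectMatching {V : Type*} {G : SimpleGraph V} {M : G.Subgraph}
    (hM : M.IsPerfectMatching) {x y : V} (hxy : M.Adj x y) :
    ∃ f : V → V, Function.Injective f ∧ (∀ v, G.Adj v (f v)) ∧ f x = y := by
  rw [Subgraph.isPerfectMatching_iff] at hM
  choose f hf hu using hM
  refine ⟨f, fun v w hvw => ?_, fun v => (hf v).adj_sub, (hu x y hxy).symm⟩
  have h1 := (hf v).symm
  have h2 := (hf w).symm
  rw [← hvw] at h2
  exact (hu _ _ h1).trans (hu _ _ h2).symm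

section Graph

variable {V : Type*} [Fintype V] [DecidableEq V] {G : SimpleGraph V} {A : Finset V}

lemma mem_relNbrs_sideRel (hs : IsSide G A) {S : Finset V} (hS : S ⊆ A) {y : V} :
    y ∈ relNbrs Aᶜ (sideRel G A) S ↔ ∃ x ∈ S, G.Adj x y := by
  rw [mem_relNbrs, Finset.mem_compl]
  constructor
  · rintro ⟨_, x, hx, hxy⟩
    exact ⟨x, hx, hxy.1⟩
  · rintro ⟨x, hx, hxy⟩
    exact ⟨(hs x y hxy).1 (hS hx), x, hx, hxy, hS hx⟩

lemma card_eq_of_matchingCovered (hs : IsSide G A) (hG : MatchingCovered G) :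
    A.card = Aᶜ.card := by
  obtain ⟨hc, h4, hM⟩ := hG
  have : Nontrivial V := Fintype.one_lt_card_iff_nontrivial.1 (by omega)
  obtain ⟨x⟩ := hc.nonempty
  obtain ⟨y, hxy⟩ := hc.preconnected.exists_adj_of_nontrivial x
  obtain ⟨M, hM, he⟩ := hM s(x, y) hxy
  obtain ⟨f, hf, hadj, -⟩ := exists_injective_of_isPerfectMatching hM he
  apply le_antisymm
  · refine Finset.card_le_card_of_injOn f (fun v hv => ?_) hf.injOn
    simpa using (hs _ _ (hadj v)).1 hv
  · refine Finset.card_le_card_of_injOn f (fun v hv => ?_) hf.injOn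
    have := hs _ _ (hadj v)
    simp only [Finset.coe_compl, Set.mem_compl_iff, Finset.mem_coe] at hv ⊢
    tauto

lemma surplus_of_matchingCovered (hs : IsSide G A) (hG : MatchingCovered G) (S : Finset V)
    (hS : S ⊆ A) (hne : S.Nonempty) (hSA : S ≠ A) :
    S.card + 1 ≤ (relNbrs Aᶜ (sideRel G A) S).card := by
  set N := relNbrs Aᶜ (sideRel G A) S with hN
  by_contra hlt
  obtain ⟨hc, h4, hM⟩ := hG
  obtain ⟨s, hsS⟩ := hne
  obtain ⟨t, htA, htS⟩ := Finset.exists_of_ssubset (hS.ssubset_of_ne hSA)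
  obtain ⟨p⟩ := hc.preconnected s t
  obtain ⟨d, -, hd1, hd2⟩ := p.exists_boundary_dart {v | v ∈ S ∨ v ∈ N} (Or.inl hsS) (by
    rintro (h | h)
    · exact htS h
    · exact (Finset.mem_compl.1 (mem_relNbrs.1 h).1) htA)
  have hd := d.adj
  rcases hd1 with h | h
  · exact hd2 (Or.inr ((mem_relNbrs_sideRel hs hS).2 ⟨_, h, hd⟩))
  · have hdS : d.snd ∉ S := fun h => hd2 (Or.inl h)
    obtain ⟨M, hM, he⟩ := hM s(d.snd, d.fst) hd.symm
    obtain ⟨f, hf, hadj, hfx⟩ := exists_injective_of_isPerfectMatching hM he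
    have hsub : S.image f ⊆ N := by
      intro y hy
      obtain ⟨v, hv, rfl⟩ := Finset.mem_image.1 hy
      exact (mem_relNbrs_sideRel hs hS).2 ⟨v, hv, hadj v⟩
    have heq := Finset.eq_of_subset_of_card_le hsub (by
      rw [Finset.card_image_of_injective _ hf]
      omega)
    rw [← heq] at h
    obtain ⟨v, hv, hvd⟩ := Finset.mem_image.1 h
    have hvd' : v = d.snd := hf (hvd.trans hfx.symm)
    exact hdS (hvd' ▸ hv)

lemma connected_of_surplus (hs : IsSide G A) (hcard : A.card = Aᶜ.card) [Nonempty V]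
    (hsur : ∀ S ⊆ A, S.Nonempty → S ≠ A → S.card + 1 ≤ (relNbrs Aᶜ (sideRel G A) S).card)
    (hdeg : ∀ v ∉ A, ∃ w, G.Adj v w) : G.Connected := by
  classical
  refine ⟨fun u v => ?_⟩
  set K := A.filter (fun w => G.Reachable u w) with hK
  set L := Aᶜ.filter (fun w => G.Reachable u w) with hL
  have hKA : K ⊆ A := Finset.filter_subset _ _
  have hLA : L ⊆ Aᶜ := Finset.filter_subset _ _
  have hKne : K.Nonempty := by
    by_cases hu : u ∈ A
    · exact ⟨u, by simp [hK, hu]⟩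
    · obtain ⟨w, hw⟩ := hdeg u hu
      exact ⟨w, Finset.mem_filter.2 ⟨(hs w u hw.symm).2 hu, hw.reachable⟩⟩
  by_cases hKe : K = A
  · have hall : ∀ w ∈ A, G.Reachable u w := fun w hw => (Finset.mem_filter.1 (hKe ▸ hw)).2
    by_cases hv : v ∈ A
    · exact hall v hv
    · obtain ⟨w, hw⟩ := hdeg v hv
      exact (hall w ((hs w v hw.symm).2 hv)).trans hw.symm.reachable
  · exfalso
    have h1 := hsur K hKA hKne hKe
    have h2 := hsur (A \ K) Finset.sdiff_subset
      (Finset.sdiff_nonempty.2 fun h => hKe (hKA.antisymm h)) (by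
        intro h
        obtain ⟨w, hw⟩ := hKne
        have := hKA hw
        rw [← h] at this
        exact (Finset.mem_sdiff.1 this).2 hw)
    have h3 : relNbrs Aᶜ (sideRel G A) K ⊆ L := by
      intro y hy
      obtain ⟨hyB, x, hx, hxy⟩ := mem_relNbrs.1 hy
      exact Finset.mem_filter.2 ⟨hyB, (Finset.mem_filter.1 hx).2.trans hxy.1.reachable⟩
    have h4 : relNbrs Aᶜ (sideRel G A) (A \ K) ⊆ Aᶜ \ L := by
      intro y hy
      obtain ⟨hyB, x, hx, hxy⟩ := mem_relNbrs.1 hy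
      rw [Finset.mem_sdiff] at hx ⊢
      exact ⟨hyB, fun h => hx.2 (Finset.mem_filter.2
        ⟨hx.1, (Finset.mem_filter.1 h).2.trans hxy.1.symm.reachable⟩)⟩
    have h5 := Finset.card_le_card h3
    have h6 := Finset.card_le_card h4
    rw [Finset.card_sdiff_of_subset hLA] at h6
    rw [Finset.card_sdiff_of_subset hKA] at h2
    have h7 := Finset.card_le_card hKA
    have h8 := Finset.card_le_card hLA
    omega

lemma exists_isPerfectMatching_of_injOn (hs : IsSide G A) (hcard : A.card = Aᶜ.card) {g : V → V}
    (hg : Set.InjOn g A) (hadj : ∀ v ∈ A, G.Adj v (g v)) :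
    ∃ M : G.Subgraph, M.IsPerfectMatching ∧ ∀ v ∈ A, M.Adj v (g v) := by
  have hgA : ∀ v ∈ A, g v ∉ A := fun v hv => (hs _ _ (hadj v hv)).1 hv
  have himg : A.image g = Aᶜ := by
    refine Finset.eq_of_subset_of_card_le (fun y hy => ?_) ?_
    · obtain ⟨v, hv, rfl⟩ := Finset.mem_image.1 hy
      exact Finset.mem_compl.2 (hgA v hv)
    · rw [Finset.card_image_of_injOn hg, hcard]
  refine ⟨{ verts := Set.univ
            Adj := fun u v => (u ∈ A ∧ g u = v) ∨ (v ∈ A ∧ g v = u)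
            adj_sub := ?_
            edge_vert := fun _ => Set.mem_univ _
            symm := ?_ }, ?_, fun v hv => Or.inl ⟨hv, rfl⟩⟩
  · rintro u v (⟨hu, rfl⟩ | ⟨hv, rfl⟩)
    · exact hadj u hu
    · exact (hadj v hv).symm
  · exact ⟨fun u v h => h.symm⟩
  · rw [Subgraph.isPerfectMatching_iff]
    intro v
    by_cases hv : v ∈ A
    · refine ⟨g v, Or.inl ⟨hv, rfl⟩, ?_⟩
      rintro w (⟨-, rfl⟩ | ⟨hw, rfl⟩)
      · rfl
      · exact absurd hv (hgA w hw)
    · have hv' := Finset.mem_compl.2 hv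
      rw [← himg, Finset.mem_image] at hv'
      obtain ⟨w, hw, rfl⟩ := hv'
      refine ⟨w, Or.inr ⟨hw, rfl⟩, ?_⟩
      rintro z (⟨hz, -⟩ | ⟨hz, hzw⟩)
      · exact absurd hz hv
      · exact hg hz hw hzw

lemma exists_injOn_of_surplus (hs : IsSide G A)
    (hsur : ∀ S ⊆ A, S.Nonempty → S ≠ A → S.card + 1 ≤ (relNbrs Aᶜ (sideRel G A) S).card)
    {x y : V} (hx : x ∈ A) (hxy : G.Adj x y) :
    ∃ g : V → V, Set.InjOn g A ∧ (∀ v ∈ A, G.Adj v (g v)) ∧ g x = y := by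
  classical
  let t : {a // a ∈ A.erase x} → Finset V :=
    fun a => Finset.univ.filter fun w => G.Adj a w ∧ w ≠ y
  obtain ⟨f, hf, hft⟩ := (Finset.all_card_le_biUnion_card_iff_exists_injective t).1 (by
    intro s
    rcases s.eq_empty_or_nonempty with rfl | hne
    · simp
    set S := s.map (Function.Embedding.subtype _) with hSdef
    have hcS : S.card = s.card := Finset.card_map _
    have hSe : ∀ v ∈ S, v ∈ A.erase x := by
      intro v hv
      obtain ⟨w, -, rfl⟩ := Finset.mem_map.1 hv
      exact w.2
    have hSA : S ⊆ A := fun v hv => Finset.mem_of_mem_erase (hSe v hv)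
    have h1 := hsur S hSA (Finset.card_pos.1 (hcS ▸ hne.card_pos)) (by
      intro h
      have := hSe x (h ▸ hx)
      simp at this)
    have h2 : (relNbrs Aᶜ (sideRel G A) S).erase y ⊆ s.biUnion t := by
      intro w hw
      obtain ⟨hwy, hw⟩ := Finset.mem_erase.1 hw
      obtain ⟨v, hv, hvw⟩ := (mem_relNbrs_sideRel hs hSA).1 hw
      obtain ⟨v', hv', rfl⟩ := Finset.mem_map.1 hv
      exact Finset.mem_biUnion.2 ⟨v', hv', by simpa [t] using ⟨hvw, hwy⟩⟩
    have h3 := Finset.card_le_card h2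
    have h4 := Finset.pred_card_le_card_erase (s := relNbrs Aᶜ (sideRel G A) S) (a := y)
    omega)
  have hft' : ∀ a : {a // a ∈ A.erase x}, G.Adj a (f a) ∧ f a ≠ y :=
    fun a => by simpa [t] using hft a
  refine ⟨fun v => if h : v ∈ A.erase x then f ⟨v, h⟩ else y, ?_, ?_, ?_⟩
  · intro v hv w hw hvw
    simp only [Finset.mem_coe] at hv hw
    by_cases hvx : v = x <;> by_cases hwx : w = x
    · rw [hvx, hwx]
    · exact absurd (by simpa [hvx, hwx, hw] using hvw.symm)
        (hft' ⟨w, Finset.mem_erase.2 ⟨hwx, hw⟩⟩).2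
    · exact absurd (by simpa [hvx, hwx, hv] using hvw) (hft' ⟨v, Finset.mem_erase.2 ⟨hvx, hv⟩⟩).2
    · have := hf (a₁ := ⟨v, by simp [hvx, hv]⟩) (a₂ := ⟨w, by simp [hwx, hw]⟩)
        (by simpa [hvx, hwx, hv, hw] using hvw)
      simpa using this
  · intro v hv
    by_cases hvx : v = x
    · subst hvx
      simpa using hxy
    · simpa [hvx, hv] using (hft' ⟨v, by simp [hvx, hv]⟩).1
  · simp

lemma matchingCovered_of_surplus (hs : IsSide G A) (hcard : A.card = Aᶜ.card)
    (h4 : 4 ≤ Fintype.card V)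
    (hsur : ∀ S ⊆ A, S.Nonempty → S ≠ A → S.card + 1 ≤ (relNbrs Aᶜ (sideRel G A) S).card)
    (hdeg : ∀ v ∉ A, ∃ w, G.Adj v w) : MatchingCovered G := by
  have : Nonempty V := Fintype.card_pos_iff.1 (by omega)
  have key : ∀ x y, G.Adj x y → x ∈ A →
      ∃ M : G.Subgraph, M.IsPerfectMatching ∧ s(x, y) ∈ M.edgeSet := by
    intro x y hxy hx
    obtain ⟨g, hg, hadj, hgx⟩ := exists_injOn_of_surplus hs hsur hx hxy
    obtain ⟨M, hM, hMg⟩ := exists_isPerfectMatching_of_injOn hs hcard hg hadj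
    exact ⟨M, hM, hgx ▸ hMg x hx⟩
  refine ⟨connected_of_surplus hs hcard hsur hdeg, h4, fun e => ?_⟩
  induction e with
  | _ x y =>
    intro hxy
    rw [mem_edgeSet] at hxy
    by_cases hx : x ∈ A
    · exact key x y hxy hx
    · rw [Sym2.eq_swap]
      exact key y x hxy.symm ((hs y x hxy.symm).2 hx)

lemma tightCover_of_minimal (hs : IsSide G A) (hG : MinimalMatchingCovered G) :
    TightCover A Aᶜ (sideRel G A) where
  left_mem h := h.2
  right_mem h := Finset.mem_compl.2 ((hs _ _ h.1).1 h.2)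
  card_eq := card_eq_of_matchingCovered hs hG.1
  surplus := surplus_of_matchingCovered hs hG.1
  tight := by
    intro x y hxy _ hy
    by_contra hcon
    have hsur := surplus_of_matchingCovered hs hG.1
    have hyA : y ∉ A := (hs _ _ hxy.1).1 hxy.2
    have hmin := hG.2 s(x, y) hxy.1
    obtain ⟨G', hG'⟩ : ∃ G', G' = G.deleteEdges {s(x, y)} := ⟨_, rfl⟩
    rw [← hG'] at hmin
    have hadj : ∀ u v, G'.Adj u v ↔ G.Adj u v ∧ s(u, v) ≠ s(x, y) := by
      intro u v
      simp [hG', deleteEdges_adj]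
    have hs' : IsSide G' A := fun u v h => hs u v ((hadj u v).1 h).1
    refine hmin (matchingCovered_of_surplus hs'
      (card_eq_of_matchingCovered hs hG.1) hG.1.2.1 ?_ ?_)
    · intro S hS hne hSA
      by_contra hlt
      have h1 := hsur S hS hne hSA
      have h2 : (relNbrs Aᶜ (sideRel G A) S).erase y ⊆ relNbrs Aᶜ (sideRel G' A) S := by
        intro w hw
        obtain ⟨hwy, hw⟩ := Finset.mem_erase.1 hw
        obtain ⟨v, hv, hvw⟩ := (mem_relNbrs_sideRel hs hS).1 hw
        refine (mem_relNbrs_sideRel hs' hS).2 ⟨v, hv, (hadj v w).2 ⟨hvw, fun h => ?_⟩⟩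
        rcases Sym2.eq_iff.1 h with h | h
        · exact hwy h.2
        · exact hyA (h.1 ▸ hS hv)
      have h3 := Finset.card_le_card h2
      have h4 := Finset.pred_card_le_card_erase (s := relNbrs Aᶜ (sideRel G A) S) (a := y)
      have hy1 : y ∈ relNbrs Aᶜ (sideRel G A) S := by
        by_contra h
        rw [Finset.erase_eq_of_notMem h] at h3
        omega
      have hy2 : y ∉ relNbrs Aᶜ (sideRel G' A) S := by
        intro h
        have := Finset.card_le_card (Finset.insert_subset h h2)
        rw [Finset.insert_erase hy1] at this
        omega
      have hu : ∀ z ∈ S, sideRel G A z y → z = x := by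
        intro z hz hzy
        by_contra hzx
        refine hy2 ((mem_relNbrs_sideRel hs' hS).2 ⟨z, hz, (hadj z y).2 ⟨hzy.1, fun h => ?_⟩⟩)
        rcases Sym2.eq_iff.1 h with h | h
        · exact hzx h.1
        · exact hyA (h.1 ▸ hS hz)
      obtain ⟨-, z, hz, hzy⟩ := mem_relNbrs.1 hy1
      exact hcon ⟨S, hS, hu z hz hzy ▸ hz, by omega, hu⟩
    · intro v hv
      by_cases hvy : v = y
      · subst hvy
        obtain ⟨w, -, hw, hwx⟩ := exists_ne_of_relDeg x (le_trans (by norm_num) hy)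
        exact ⟨w, (hadj v w).2 ⟨hw.1.symm, fun h => hwx (by
          rcases Sym2.eq_iff.1 h with h | h
          · exact absurd (h.1 ▸ hxy.2) hv
          · exact h.2)⟩⟩
      · have h4 := hG.1.2.1
        have : Nontrivial V := Fintype.one_lt_card_iff_nontrivial.1 (by omega)
        obtain ⟨w, hw⟩ := hG.1.1.preconnected.exists_adj_of_nontrivial v
        refine ⟨w, (hadj v w).2 ⟨hw, fun h => ?_⟩⟩
        rcases Sym2.eq_iff.1 h with h | h
        · exact hv (h.1 ▸ hxy.2)
        · exact hvy h.1

end Graph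

lemma exists_degree_two_three_iff {V : Type*} {G : SimpleGraph V} {x y : V} :
    (∃ u v, s(x, y) = s(u, v) ∧ degN G u = 2 ∧ 3 ≤ degN G v) ↔
      (degN G x = 2 ∧ 3 ≤ degN G y) ∨ (degN G y = 2 ∧ 3 ≤ degN G x) := by
  constructor
  · rintro ⟨u, v, h, hu, hv⟩
    rcases Sym2.eq_iff.1 h with ⟨rfl, rfl⟩ | ⟨rfl, rfl⟩
    · exact Or.inl ⟨hu, hv⟩
    · exact Or.inr ⟨hu, hv⟩
  · rintro (h | h)
    · exact ⟨x, y, rfl, h⟩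
    · exact ⟨y, x, Sym2.eq_swap, h⟩

section Counting

variable {V : Type*} [Fintype V] [DecidableEq V] {G : SimpleGraph V} {A : Finset V}

lemma relDeg_sideRel (hs : IsSide G A) {x : V} (hx : x ∈ A) :
    relDeg Aᶜ (sideRel G A) x = degN G x := by
  classical
  have h : G.neighborSet x = (Aᶜ.filter fun y => sideRel G A x y : Finset V) := by
    ext y
    rw [mem_neighborSet, Finset.mem_coe, Finset.mem_filter, Finset.mem_compl]
    exact ⟨fun h => ⟨(hs x y h).1 hx, h, hx⟩, fun h => h.2.1⟩
  rw [relDeg, degN, h, Set.ncard_coe_finset]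

lemma relDeg_flip_sideRel (hs : IsSide G A) {y : V} (hy : y ∈ Aᶜ) :
    relDeg A (flip (sideRel G A)) y = degN G y := by
  classical
  rw [Finset.mem_compl] at hy
  have h : G.neighborSet y = (A.filter fun x => flip (sideRel G A) y x : Finset V) := by
    ext x
    rw [mem_neighborSet, Finset.mem_coe, Finset.mem_filter]
    exact ⟨fun h => ⟨(hs x y h.symm).2 hy, h.symm, (hs x y h.symm).2 hy⟩, fun h => h.2.1.symm⟩
  rw [relDeg, degN, h, Set.ncard_coe_finset]

open scoped Classical in
lemma ncard_edges (hs : IsSide G A) (P : Sym2 V → Prop) :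
    {e | e ∈ G.edgeSet ∧ P e}.ncard =
      ((relPairs A Aᶜ (sideRel G A)).filter fun p => P s(p.1, p.2)).card := by
  rw [← Set.ncard_coe_finset, ← Set.InjOn.ncard_image (f := fun p : V × V => s(p.1, p.2))]
  · congr 1
    ext e
    induction e with
    | _ x y =>
      simp only [Set.mem_ofPred_eq, mem_edgeSet, Finset.coe_filter, mem_relPairs, Set.mem_image,
        Finset.mem_compl, sideRel]
      constructor
      · rintro ⟨hxy, hP⟩
        by_cases hx : x ∈ A
        · exact ⟨(x, y), ⟨⟨⟨hx, (hs x y hxy).1 hx⟩, hxy, hx⟩, hP⟩, rfl⟩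
        · have hy := (hs y x hxy.symm).2 hx
          exact ⟨(y, x), ⟨⟨⟨hy, hx⟩, hxy.symm, hy⟩, by rwa [Sym2.eq_swap]⟩, Sym2.eq_swap⟩
      · rintro ⟨p, ⟨⟨-, hp, -⟩, hP⟩, he⟩
        rw [he] at hP
        refine ⟨?_, hP⟩
        rw [← mem_edgeSet, ← he]
        exact hp
  · rintro ⟨x, y⟩ hp ⟨x', y'⟩ hq h
    simp only [Finset.coe_filter, mem_relPairs, Finset.mem_compl, Set.mem_ofPred_eq] at hp hq
    rcases Sym2.eq_iff.1 h with h | h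
    · exact Prod.ext h.1 h.2
    · have hxy : x = y' := h.1
      exact absurd (hxy ▸ hp.1.1.1) hq.1.1.2

lemma ncard_vertices (P : V → Prop) [DecidablePred P] :
    {v | P v}.ncard = (A.filter P).card + (Aᶜ.filter P).card := by
  rw [← Finset.card_union_of_disjoint
    (Finset.disjoint_filter_filter disjoint_compl_right), ← Finset.filter_union,
    Finset.union_compl, ← Set.ncard_coe_finset]
  congr 1
  ext v
  simp

lemma nonempty_iso_cycleGraph_four (hs : IsSide G A) (hA : A.card = 2) (hB : Aᶜ.card = 2)
    (hdeg : ∀ v, degN G v = 2) : Nonempty (G ≃g cycleGraph 4) := by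
  classical
  have hadj : ∀ x ∈ A, ∀ y ∈ Aᶜ, G.Adj x y := by
    intro x hx y hy
    have h1 := relDeg_sideRel hs hx
    rw [hdeg x, relDeg, ← hB] at h1
    have h2 := Finset.eq_of_subset_of_card_le (Finset.filter_subset _ _) h1.ge
    rw [← h2, Finset.mem_filter] at hy
    exact hy.2.1
  obtain ⟨a, c, hac, hAe⟩ := Finset.card_eq_two.1 hA
  obtain ⟨b, d, hbd, hBe⟩ := Finset.card_eq_two.1 hB
  have ha : a ∈ A := by simp [hAe]
  have hc : c ∈ A := by simp [hAe]
  have hb : b ∈ Aᶜ := by simp [hBe]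
  have hd : d ∈ Aᶜ := by simp [hBe]
  have hab := hadj a ha b hb
  have had := hadj a ha d hd
  have hcb := hadj c hc b hb
  have hcd := hadj c hc d hd
  rw [Finset.mem_compl] at hb hd
  have hnac : ¬ G.Adj a c := fun h => (hs a c h).1 ha hc
  have hnbd : ¬ G.Adj b d := fun h => hb ((hs b d h).2 hd)
  have hf : Function.Bijective ![a, b, c, d] := by
    constructor
    · have := hab.ne
      have := had.ne
      have := hcb.ne
      have := hcd.ne
      intro i j
      fin_cases i <;> fin_cases j <;> simp <;> grind
    · intro v
      by_cases hv : v ∈ A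
      · rw [hAe, Finset.mem_insert, Finset.mem_singleton] at hv
        rcases hv with rfl | rfl
        · exact ⟨0, rfl⟩
        · exact ⟨2, rfl⟩
      · rw [← Finset.mem_compl, hBe, Finset.mem_insert, Finset.mem_singleton] at hv
        rcases hv with rfl | rfl
        · exact ⟨1, rfl⟩
        · exact ⟨3, rfl⟩
  refine ⟨(RelIso.symm ⟨Equiv.ofBijective _ hf, ?_⟩ : G ≃g cycleGraph 4)⟩
  intro i j
  simp only [Equiv.ofBijective_apply, cycleGraph_adj]
  fin_cases i <;> fin_cases j <;>
    simp [hab, had, hcb, hcd, hnac, hnbd, hab.symm, had.symm, hcb.symm, hcd.symm,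
      mt G.adj_symm hnac, mt G.adj_symm hnbd] <;> decide

lemma two_mul_ncard_degree_two (hs : IsSide G A) (hA : ∀ v, degN G v = 2 ∨ 3 ≤ degN G v) :
    2 * {v | degN G v = 2}.ncard =
      2 * {e | e ∈ G.edgeSet ∧ ∀ v ∈ e, degN G v = 2}.ncard +
        {e | e ∈ G.edgeSet ∧ ∃ u v, e = s(u, v) ∧ degN G u = 2 ∧ 3 ≤ degN G v}.ncard := by
  classical
  have hL : 2 * (A.filter fun v => degN G v = 2).card =
      ((relPairs A Aᶜ (sideRel G A)).filter fun p => degN G p.1 = 2).card := by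
    have h1 : (relPairs A Aᶜ (sideRel G A)).filter (fun p => degN G p.1 = 2) =
        relPairs (A.filter fun v => degN G v = 2) Aᶜ (sideRel G A) := by
      ext p
      simp only [Finset.mem_filter, mem_relPairs]
      tauto
    rw [h1, card_relPairs, Finset.sum_congr rfl (g := fun _ => 2), Finset.sum_const, smul_eq_mul,
      mul_comm]
    intro v hv
    rw [Finset.mem_filter] at hv
    rw [relDeg_sideRel hs hv.1, hv.2]
  have hR : 2 * (Aᶜ.filter fun v => degN G v = 2).card =
      ((relPairs A Aᶜ (sideRel G A)).filter fun p => degN G p.2 = 2).card := by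
    have h1 : (relPairs A Aᶜ (sideRel G A)).filter (fun p => degN G p.2 = 2) =
        relPairs A (Aᶜ.filter fun v => degN G v = 2) (sideRel G A) := by
      ext p
      simp only [Finset.mem_filter, mem_relPairs]
      tauto
    rw [h1, card_relPairs', Finset.sum_congr rfl (g := fun _ => 2), Finset.sum_const, smul_eq_mul,
      mul_comm]
    intro v hv
    rw [Finset.mem_filter] at hv
    rw [relDeg_flip_sideRel hs hv.1, hv.2]
  rw [ncard_vertices (A := A), mul_add, hL, hR, ncard_edges hs, ncard_edges hs]
  simp only [Finset.card_filter, Finset.mul_sum, ← Finset.sum_add_distrib]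
  refine Finset.sum_congr rfl fun p _ => ?_
  simp only [exists_degree_two_three_iff, Sym2.mem_iff, forall_eq_or_imp, forall_eq]
  have := hA p.1
  have := hA p.2
  split_ifs <;> omega

lemma ncard_edgeSet_eq (hs : IsSide G A) (hA : ∀ v, degN G v = 2 ∨ 3 ≤ degN G v) :
    G.edgeSet.ncard =
      {e | e ∈ G.edgeSet ∧ ∀ v ∈ e, degN G v = 2}.ncard +
        {e | e ∈ G.edgeSet ∧ ∃ u v, e = s(u, v) ∧ degN G u = 2 ∧ 3 ≤ degN G v}.ncard +
        {e | e ∈ G.edgeSet ∧ ∀ v ∈ e, 3 ≤ degN G v}.ncard := by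
  classical
  have h := ncard_edges hs (fun _ => True)
  simp only [and_true, Set.ofPred_mem_eq, Finset.filter_true] at h
  rw [h, ncard_edges hs, ncard_edges hs, ncard_edges hs, Finset.card_eq_sum_ones]
  simp only [Finset.card_filter, ← Finset.sum_add_distrib]
  refine Finset.sum_congr rfl fun p _ => ?_
  simp only [exists_degree_two_three_iff, Sym2.mem_iff, forall_eq_or_imp, forall_eq]
  have := hA p.1
  have := hA p.2
  split_ifs <;> omega

lemma card_heavyRel_sideRel (hs : IsSide G A) :
    (relPairs A Aᶜ (heavyRel A Aᶜ (sideRel G A))).card =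
      {e | e ∈ G.edgeSet ∧ ∀ v ∈ e, 3 ≤ degN G v}.ncard := by
  classical
  rw [ncard_edges hs]
  congr 1
  ext p
  simp only [Finset.mem_filter, mem_relPairs, heavyRel, Sym2.mem_iff, forall_eq_or_imp, forall_eq]
  constructor
  · rintro ⟨⟨h1, h2⟩, h3, h4, h5⟩
    rw [relDeg_sideRel hs h1] at h4
    rw [relDeg_flip_sideRel hs h2] at h5
    exact ⟨⟨⟨h1, h2⟩, h3⟩, h4, h5⟩
  · rintro ⟨⟨⟨h1, h2⟩, h3⟩, h4, h5⟩
    rw [relDeg_sideRel hs h1, relDeg_flip_sideRel hs h2]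
    exact ⟨⟨h1, h2⟩, h3, h4, h5⟩

lemma card_semiheavyRel_sideRel (hs : IsSide G A) (hA : ∀ v, degN G v = 2 ∨ 3 ≤ degN G v) :
    (relPairs A Aᶜ (semiheavyRel A Aᶜ (sideRel G A))).card =
      {e | e ∈ G.edgeSet ∧ ∃ u v, e = s(u, v) ∧ degN G u = 2 ∧ 3 ≤ degN G v}.ncard +
        {e | e ∈ G.edgeSet ∧ ∀ v ∈ e, 3 ≤ degN G v}.ncard := by
  classical
  have h1 : relPairs A Aᶜ (semiheavyRel A Aᶜ (sideRel G A)) =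
      (relPairs A Aᶜ (sideRel G A)).filter
        fun p => 3 ≤ degN G p.1 ∨ 3 ≤ degN G p.2 := by
    ext p
    simp only [Finset.mem_filter, mem_relPairs, semiheavyRel]
    constructor
    · rintro ⟨⟨h1, h2⟩, h3, h4⟩
      rw [relDeg_sideRel hs h1, relDeg_flip_sideRel hs h2] at h4
      exact ⟨⟨⟨h1, h2⟩, h3⟩, h4⟩
    · rintro ⟨⟨⟨h1, h2⟩, h3⟩, h4⟩
      rw [relDeg_sideRel hs h1, relDeg_flip_sideRel hs h2]
      exact ⟨⟨h1, h2⟩, h3, h4⟩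
  rw [h1, ncard_edges hs, ncard_edges hs]
  simp only [Finset.card_filter, ← Finset.sum_add_distrib]
  refine Finset.sum_congr rfl fun p _ => ?_
  simp only [exists_degree_two_three_iff, Sym2.mem_iff, forall_eq_or_imp, forall_eq]
  have := hA p.1
  have := hA p.2
  split_ifs <;> omega

lemma card_heavyPart_sideRel (hs : IsSide G A) :
    (heavyPart A Aᶜ (sideRel G A)).card + (heavyPart Aᶜ A (flip (sideRel G A))).card =
      {v | 3 ≤ degN G v}.ncard := by
  classical
  rw [ncard_vertices (A := A)]
  congr 2
  · ext v
    rw [mem_heavyPart, Finset.mem_filter]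
    refine and_congr_right fun hv => ?_
    rw [relDeg_sideRel hs hv]
  · ext v
    rw [mem_heavyPart, Finset.mem_filter]
    refine and_congr_right fun hv => ?_
    rw [relDeg_flip_sideRel hs hv]

lemma ncard_degree_two_add (hA : ∀ v, degN G v = 2 ∨ 3 ≤ degN G v) :
    {v | degN G v = 2}.ncard + {v | 3 ≤ degN G v}.ncard = Fintype.card V := by
  classical
  rw [ncard_vertices (A := Finset.univ), ncard_vertices (A := Finset.univ), ← Finset.card_univ,
    ← Finset.card_filter_add_card_filter_not (s := Finset.univ) (fun v => degN G v = 2)]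
  have : Finset.univ.filter (fun v => 3 ≤ degN G v) =
      Finset.univ.filter (fun v => ¬ degN G v = 2) := by
    refine Finset.filter_congr fun v _ => ?_
    have := hA v
    omega
  simp [this]

lemma two_or_three_le_degN (hs : IsSide G A) (h : TightCover A Aᶜ (sideRel G A))
    (hA : 2 ≤ A.card) (v : V) : degN G v = 2 ∨ 3 ≤ degN G v := by
  suffices 2 ≤ degN G v by omega
  by_cases hv : v ∈ A
  · rw [← relDeg_sideRel hs hv]
    exact h.two_le_relDeg hA hv
  · rw [← Finset.mem_compl] at hv
    rw [← relDeg_flip_sideRel hs hv]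
    exact h.symm.two_le_relDeg (h.card_eq ▸ hA) hv

end Counting

/-- Counting properties of a 2-vertex extremal minimal bipartite matching covered graph other
than the 4-cycle: `|V₃| = 3n - 2m - 4`, `|E₃₂| = 2m - 2n + 4` and `|E₃| = 3n - 2m - 6`. -/
theorem stmt14 {V : Type*} [Fintype V] (G : SimpleGraph V)
    (hbip : G.Colorable 2) (hmin : MinimalMatchingCovered G)
    (hC4 : IsEmpty (G ≃g cycleGraph 4))
    (hext : {v | degN G v = 2}.ncard + 2 * Fintype.card V = 2 * G.edgeSet.ncard + 4) :
    2 * G.edgeSet.ncard + {v | 3 ≤ degN G v}.ncard + 4 = 3 * Fintype.card V ∧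
      {e | e ∈ G.edgeSet ∧ ∃ u v, e = s(u, v) ∧ degN G u = 2 ∧ 3 ≤ degN G v}.ncard
          + 2 * Fintype.card V
        = 2 * G.edgeSet.ncard + 4 ∧
      2 * G.edgeSet.ncard + {e | e ∈ G.edgeSet ∧ ∀ v ∈ e, 3 ≤ degN G v}.ncard + 6
        = 3 * Fintype.card V := by
  classical
  obtain ⟨C⟩ := hbip
  obtain ⟨A, hs⟩ : ∃ A, IsSide G A := by
    refine ⟨Finset.univ.filter fun v => C v = 0, fun u v huv => ?_⟩
    have := C.valid huv
    simp only [Finset.mem_filter_univ]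
    omega
  have h := tightCover_of_minimal hs hmin
  have hn4 := hmin.1.2.1
  have hn := Finset.card_add_card_compl A
  have hcard := h.card_eq
  have hA2 : 2 ≤ A.card := by omega
  have hdeg := two_or_three_le_degN hs h hA2
  have h1 := two_mul_ncard_degree_two hs hdeg
  have h2 := ncard_edgeSet_eq hs hdeg
  have h3 := card_heavyRel_sideRel hs
  have h4 := card_semiheavyRel_sideRel hs hdeg
  have h5 := card_heavyPart_sideRel hs
  have h6 := ncard_degree_two_add hdeg
  have hB : (heavyPart Aᶜ A (flip (sideRel G A))).Nonempty := by
    by_contra hB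
    have hA : ¬ (heavyPart A Aᶜ (sideRel G A)).Nonempty :=
      fun hA => hB (h.symm.exists_heavy_left (hcard ▸ hA2) hA)
    rw [Finset.not_nonempty_iff_eq_empty] at hA hB
    rw [hA, hB, Finset.card_empty, add_zero] at h5
    have hall : ∀ v, ¬ 3 ≤ degN G v := by
      intro v hv
      have := (Set.ncard_eq_zero (Set.toFinite _)).1 h5.symm
      exact Set.eq_empty_iff_forall_notMem.1 this v hv
    have h7 : {e | e ∈ G.edgeSet ∧ ∃ u v, e = s(u, v) ∧ degN G u = 2 ∧ 3 ≤ degN G v} = ∅ := by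
      refine Set.eq_empty_iff_forall_notMem.2 ?_
      rintro e ⟨-, u, v, -, -, hv⟩
      exact hall v hv
    have h8 : {e | e ∈ G.edgeSet ∧ ∀ v ∈ e, 3 ≤ degN G v} = ∅ := by
      refine Set.eq_empty_iff_forall_notMem.2 ?_
      rintro e ⟨-, he⟩
      exact hall _ (he _ (Sym2.out_fst_mem e))
    rw [h7, Set.ncard_empty] at h1 h2
    rw [h8, Set.ncard_empty] at h2
    obtain ⟨φ⟩ := nonempty_iso_cycleGraph_four hs (by omega) (by omega)
      (fun v => (hdeg v).resolve_right (hall v))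
    exact hC4.false φ
  have h9 := h.card_heavyRel_add_two_le hA2 hB
  have h10 := h.card_semiheavyRel_add_two_le hB
  omega
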